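/- arXiv:1905.09117 — 4 statements merged into one kernel-verified Lean document; each statement's English description precedes it below -/
import Mathlib

section
/- A behaviour (E₁,E₂,ω₁,ω₂) belongs to the quantum set Q if and only if there exist real numbers u, v, η₁, η₂ with η₁ ≤ ω₁ and η₂ ≤ ω₂ such that the 4×4 real symmetric matrix Γ with unit diagonal and off-diagonal entries Γ₁₂ = u, Γ₁₃ = E₁, Γ₁₄ = 2η₁−1, Γ₂₃ = E₂, Γ₂₄ = 2η₂−1, Γ₃₄ = v is positive semidefinite. -/
open scoped ComplexOrder

noncomputable section

/-- A behaviour `(E, ω)` admits a (finite-dimensional) quantum representation. -/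
def IsQuantumRep (E ω : Fin 2 → ℝ) : Prop :=
  ∃ (d : ℕ) (ρ : Fin 2 → Matrix (Fin d) (Fin d) ℂ)
    (M O : Matrix (Fin d) (Fin d) ℂ) (v : Fin d → ℂ),
    (∀ x, (ρ x).PosSemidef) ∧ (∀ x, (ρ x).trace = 1) ∧
    M.IsHermitian ∧ (1 - M).PosSemidef ∧ (1 + M).PosSemidef ∧
    O.IsHermitian ∧ O.mulVec v = 0 ∧ (∑ i, Complex.normSq (v i)) = 1 ∧
    (O - (1 - Matrix.vecMulVec v (star v))).PosSemidef ∧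
    (∀ x, (ρ x * M).trace = (E x : ℂ)) ∧
    (∀ x, ((ρ x * O).trace).re ≤ ω x)

/-- The quantum set `Q`: all finite convex combinations of behaviours with a
quantum representation. -/
def QuantumSet : Set ((Fin 2 → ℝ) × (Fin 2 → ℝ)) :=
  convexHull ℝ {b | IsQuantumRep b.1 b.2}

open scoped Matrix in
theorem qs_trace {d m : ℕ} (w : Fin m → (Fin d → ℂ)) (X : Matrix (Fin d) (Fin d) ℂ) :
    ((∑ i, Matrix.vecMulVec (w i) (star (w i))) * X).trace = ∑ i, star (w i) ⬝ᵥ X *ᵥ (w i) := by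
  rw [Finset.sum_mul, Matrix.trace_sum]
  refine Finset.sum_congr rfl fun i _ => ?_
  rw [Matrix.vecMulVec_mul, Matrix.trace_vecMulVec, Matrix.dotProduct_mulVec, dotProduct_comm]

open scoped Matrix in
theorem qs_decomp {d : ℕ} {A : Matrix (Fin d) (Fin d) ℂ} (hA : A.PosSemidef) :
    ∃ (m : ℕ) (w : Fin m → (Fin d → ℂ)), A = ∑ i, Matrix.vecMulVec (w i) (star (w i)) :=
  Matrix.posSemidef_iff_eq_sum_vecMulVec.mp hA

open scoped Matrix in
theorem qs_cs {d : ℕ} {A : Matrix (Fin d) (Fin d) ℂ} (hA : A.PosSemidef) (v w : Fin d → ℂ) :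
    ‖star w ⬝ᵥ A *ᵥ v‖ ^ 2 ≤ (star w ⬝ᵥ A *ᵥ w).re * (star v ⬝ᵥ A *ᵥ v).re := by
  obtain ⟨m, a, rfl⟩ := qs_decomp hA
  have h : ∀ x y : Fin d → ℂ, star x ⬝ᵥ (∑ i, Matrix.vecMulVec (a i) (star (a i))) *ᵥ y
      = ∑ i, star (star (a i) ⬝ᵥ x) * (star (a i) ⬝ᵥ y) := by
    intro x y
    rw [Matrix.sum_mulVec, dotProduct_sum]
    refine Finset.sum_congr rfl fun i _ => ?_
    rw [Matrix.vecMulVec_mulVec, ← Matrix.star_dotProduct]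
    simp [mul_comm]
  have h2 : ∀ x : Fin d → ℂ,
      (star x ⬝ᵥ (∑ i, Matrix.vecMulVec (a i) (star (a i))) *ᵥ x).re
      = ∑ i, ‖star (a i) ⬝ᵥ x‖ ^ 2 := by
    intro x
    rw [h, Complex.re_sum]
    refine Finset.sum_congr rfl fun i _ => ?_
    rw [← Complex.normSq_eq_norm_sq, Complex.star_def, ← Complex.normSq_eq_conj_mul_self,
      Complex.ofReal_re]
  rw [h2, h2, h]
  calc _ ≤ (∑ i, ‖star (a i) ⬝ᵥ w‖ * ‖star (a i) ⬝ᵥ v‖) ^ 2 := by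
        gcongr
        refine (norm_sum_le _ _).trans (le_of_eq ?_)
        simp
    _ ≤ _ := Finset.sum_mul_sq_le_sq_mul_sq _ _ _

open scoped Matrix in
theorem qs_key {d : ℕ} {M : Matrix (Fin d) (Fin d) ℂ} (h1 : (1 - M).PosSemidef)
    (h2 : (1 + M).PosSemidef) (v w : Fin d → ℂ) (t : ℝ) (ht : 0 < t) :
    4 * ‖star w ⬝ᵥ v‖ ^ 2 ≤
      (1 + t) * ((star w ⬝ᵥ (1 + M) *ᵥ w).re * (star v ⬝ᵥ (1 + M) *ᵥ v).re) +
      (1 + t⁻¹) * ((star w ⬝ᵥ (1 - M) *ᵥ w).re * (star v ⬝ᵥ (1 - M) *ᵥ v).re) := by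
  have ha := qs_cs h2 v w
  have hb := qs_cs h1 v w
  have hs : 2 * (star w ⬝ᵥ v) = star w ⬝ᵥ (1 + M) *ᵥ v + star w ⬝ᵥ (1 - M) *ᵥ v := by
    simp only [Matrix.add_mulVec, Matrix.sub_mulVec, dotProduct_add, dotProduct_sub,
      Matrix.one_mulVec]
    ring
  have hn : 2 * ‖star w ⬝ᵥ v‖ ≤ ‖star w ⬝ᵥ (1 + M) *ᵥ v‖ + ‖star w ⬝ᵥ (1 - M) *ᵥ v‖ := by
    have := norm_add_le (star w ⬝ᵥ (1 + M) *ᵥ v) (star w ⬝ᵥ (1 - M) *ᵥ v)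
    rw [← hs, norm_mul] at this
    simpa using this
  have hti : 0 < t⁻¹ := by positivity
  generalize ‖star w ⬝ᵥ (1 + M) *ᵥ v‖ = x at *
  generalize ‖star w ⬝ᵥ (1 - M) *ᵥ v‖ = y at *
  have hsq : (2 * ‖star w ⬝ᵥ v‖) ^ 2 ≤ (x + y) ^ 2 := by gcongr
  have h3 : (x + y) ^ 2 ≤ (1 + t) * x ^ 2 + (1 + t⁻¹) * y ^ 2 := by
    have e : (1 + t) * x ^ 2 + (1 + t⁻¹) * y ^ 2 - (x + y) ^ 2 = t⁻¹ * (t * x - y) ^ 2 := by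
      field_simp
      ring
    have : 0 ≤ t⁻¹ * (t * x - y) ^ 2 := by positivity
    linarith
  have h4 := mul_le_mul_of_nonneg_left ha (by linarith : (0:ℝ) ≤ 1 + t)
  have h5 := mul_le_mul_of_nonneg_left hb (by linarith : (0:ℝ) ≤ 1 + t⁻¹)
  nlinarith

open scoped Matrix in
theorem qs_state {d : ℕ} {M O ρ : Matrix (Fin d) (Fin d) ℂ} {v : Fin d → ℂ} {E ω : ℝ}
    (hρ : ρ.PosSemidef) (hρ1 : ρ.trace = 1)
    (h1 : (1 - M).PosSemidef) (h2 : (1 + M).PosSemidef)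
    (hv : (∑ i, Complex.normSq (v i)) = 1)
    (hO : (O - (1 - Matrix.vecMulVec v (star v))).PosSemidef)
    (hE : (ρ * M).trace = (E : ℂ)) (hω : ((ρ * O).trace).re ≤ ω) :
    ∃ F : ℝ, 1 - F ≤ ω ∧ ∀ t : ℝ, 0 < t →
      4 * F ≤ (1 + t) * ((1 + E) * (1 + (star v ⬝ᵥ M *ᵥ v).re)) +
        (1 + t⁻¹) * ((1 - E) * (1 - (star v ⬝ᵥ M *ᵥ v).re)) := by
  obtain ⟨m, w, hw⟩ := qs_decomp hρ
  have htr : ∀ X : Matrix (Fin d) (Fin d) ℂ, (ρ * X).trace = ∑ i, star (w i) ⬝ᵥ X *ᵥ (w i) := by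
    intro X; rw [hw]; exact qs_trace w X
  have hvv : star v ⬝ᵥ v = 1 := by
    simp only [dotProduct, Pi.star_apply, Complex.star_def, ← Complex.normSq_eq_conj_mul_self]
    exact_mod_cast hv
  have hwvw : ∀ i, star (w i) ⬝ᵥ (Matrix.vecMulVec v (star v)) *ᵥ (w i)
      = ((‖star (w i) ⬝ᵥ v‖ ^ 2 : ℝ) : ℂ) := by
    intro i
    have e : star v ⬝ᵥ w i = star (star (w i) ⬝ᵥ v) := by
      rw [← Matrix.star_dotProduct]
    rw [Matrix.vecMulVec_mulVec, ← Complex.normSq_eq_norm_sq, ← Complex.mul_conj,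
      ← Complex.star_def, ← e]
    simp [mul_comm]
  refine ⟨∑ i, ‖star (w i) ⬝ᵥ v‖ ^ 2, ?_, ?_⟩
  · have hpos : 0 ≤ (ρ * (O - (1 - Matrix.vecMulVec v (star v)))).trace.re := by
      rw [htr, Complex.re_sum]
      exact Finset.sum_nonneg fun i _ =>
        (Complex.le_def.mp (hO.dotProduct_mulVec_nonneg (w i))).1
    have e2 : (ρ * (Matrix.vecMulVec v (star v))).trace
        = ((∑ i, ‖star (w i) ⬝ᵥ v‖ ^ 2 : ℝ) : ℂ) := by
      rw [htr]; push_cast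
      exact Finset.sum_congr rfl fun i _ => by rw [hwvw]; push_cast; rfl
    rw [Matrix.mul_sub, Matrix.mul_sub, Matrix.trace_sub, Matrix.trace_sub, Matrix.mul_one, hρ1,
      e2] at hpos
    simp only [Complex.sub_re, Complex.one_re, Complex.ofReal_re] at hpos
    linarith
  · intro t ht
    have hp : (ρ * (1 + M)).trace.re = 1 + E := by
      rw [Matrix.mul_add, Matrix.trace_add, Matrix.mul_one, hρ1, hE]; simp
    have hm : (ρ * (1 - M)).trace.re = 1 - E := by
      rw [Matrix.mul_sub, Matrix.trace_sub, Matrix.mul_one, hρ1, hE]; simp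
    have vp : (star v ⬝ᵥ (1 + M) *ᵥ v).re = 1 + (star v ⬝ᵥ M *ᵥ v).re := by
      rw [Matrix.add_mulVec, dotProduct_add, Matrix.one_mulVec, hvv]; simp
    have vm : (star v ⬝ᵥ (1 - M) *ᵥ v).re = 1 - (star v ⬝ᵥ M *ᵥ v).re := by
      rw [Matrix.sub_mulVec, dotProduct_sub, Matrix.one_mulVec, hvv]; simp
    rw [← hp, ← hm, ← vp, ← vm, htr, htr, Complex.re_sum, Complex.re_sum, Finset.sum_mul,
      Finset.sum_mul, Finset.mul_sum, Finset.mul_sum, Finset.mul_sum, ← Finset.sum_add_distrib]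
    exact Finset.sum_le_sum fun i _ => qs_key h1 h2 v (w i) t ht

theorem qs_real {F E a ω : ℝ} (hF : 1 - F ≤ ω)
    (h : ∀ t : ℝ, 0 < t → 4 * F ≤ (1 + t) * ((1 + E) * (1 + a)) + (1 + t⁻¹) * ((1 - E) * (1 - a)))
    (hE : E ^ 2 ≤ 1) (ha : a ^ 2 ≤ 1) :
    ∃ η : ℝ, η ≤ ω ∧ (2 * η - 1 - (-a) * E) ^ 2 ≤ (1 - (-a) ^ 2) * (1 - E ^ 2) := by
  obtain ⟨hE1, hE2⟩ := abs_le.mp ((sq_le_one_iff_abs_le_one E).mp hE)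
  obtain ⟨ha1, ha2⟩ := abs_le.mp ((sq_le_one_iff_abs_le_one a).mp ha)
  have hx : 0 ≤ (1 + E) * (1 + a) := mul_nonneg (by linarith) (by linarith)
  have hy : 0 ≤ (1 - E) * (1 - a) := mul_nonneg (by linarith) (by linarith)
  rcases le_total (2 * F - 1 - a * E) 0 with hD | hD
  · refine ⟨(1 - a * E) / 2, by linarith, ?_⟩
    have : (1 - (-a) ^ 2) * (1 - E ^ 2) = ((1 + E) * (1 + a)) * ((1 - E) * (1 - a)) := by ring
    rw [this]
    have := mul_nonneg hx hy
    nlinarith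
  · refine ⟨1 - F, hF, ?_⟩
    have hq : ∀ t : ℝ, 0 ≤ ((1 + E) * (1 + a)) * (t * t) + (-(2 * (2 * F - 1 - a * E))) * t
        + (1 - E) * (1 - a) := by
      intro t
      rcases le_or_gt t 0 with ht | ht
      · have := mul_nonneg hx (mul_self_nonneg t)
        have := mul_nonneg hD (neg_nonneg.mpr ht)
        nlinarith
      · have h' := mul_le_mul_of_nonneg_left (h t ht) ht.le
        have e : t * ((1 + t) * ((1 + E) * (1 + a)) + (1 + t⁻¹) * ((1 - E) * (1 - a)))
          = (t + t * t) * ((1 + E) * (1 + a)) + (t + 1) * ((1 - E) * (1 - a)) := by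
          field_simp
        rw [e] at h'
        nlinarith
    have := discrim_le_zero hq
    unfold discrim at this
    nlinarith

/-- Coordinate along the second axis. -/
theorem qs_coord {E b c : ℝ} (h : (c - b * E) ^ 2 ≤ (1 - b ^ 2) * (1 - E ^ 2)) (hE : E ^ 2 ≤ 1)
    {s : ℝ} (hs : s ^ 2 = 1 - b ^ 2) : ∃ k : ℝ, k * s = c - b * E ∧ k ^ 2 + E ^ 2 ≤ 1 := by
  rw [← hs] at h
  by_cases h0 : s = 0
  · subst h0
    refine ⟨0, ?_, by linarith⟩
    have : (c - b * E) ^ 2 = 0 := le_antisymm (by linarith) (sq_nonneg _)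
    have := pow_eq_zero_iff (two_ne_zero) |>.mp this
    linarith
  · refine ⟨(c - b * E) / s, by field_simp, ?_⟩
    have hs2 : 0 < s ^ 2 := by positivity
    rw [div_pow]
    have : (c - b * E) ^ 2 / s ^ 2 ≤ 1 - E ^ 2 := by
      rw [div_le_iff₀ hs2]; linarith
    linarith

theorem qs_gram {E₁ E₂ c₁ c₂ b : ℝ} (hb : b ^ 2 ≤ 1) (hE₁ : E₁ ^ 2 ≤ 1) (hE₂ : E₂ ^ 2 ≤ 1)
    (h₁ : (c₁ - b * E₁) ^ 2 ≤ (1 - b ^ 2) * (1 - E₁ ^ 2))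
    (h₂ : (c₂ - b * E₂) ^ 2 ≤ (1 - b ^ 2) * (1 - E₂ ^ 2)) :
    ∃ u : ℝ, (!![(1:ℝ), u, E₁, c₁; u, 1, E₂, c₂; E₁, E₂, 1, b; c₁, c₂, b, 1]).PosSemidef := by
  obtain ⟨s, hs⟩ : ∃ s : ℝ, s ^ 2 = 1 - b ^ 2 := ⟨√(1 - b ^ 2), Real.sq_sqrt (by linarith)⟩
  obtain ⟨k₁, hk₁, hn₁⟩ := qs_coord h₁ hE₁ hs
  obtain ⟨k₂, hk₂, hn₂⟩ := qs_coord h₂ hE₂ hs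
  refine ⟨E₁ * E₂ + k₁ * k₂, Matrix.PosSemidef.of_dotProduct_mulVec_nonneg ?_ ?_⟩
  · ext i j; fin_cases i <;> fin_cases j <;> simp
  · intro x
    obtain rfl : c₁ = k₁ * s + b * E₁ := by linarith
    obtain rfl : c₂ = k₂ * s + b * E₂ := by linarith
    simp [Matrix.mulVec, dotProduct, Fin.sum_univ_four]
    have e1 : 0 ≤ (1 - (k₁ ^ 2 + E₁ ^ 2)) * x 0 ^ 2 := mul_nonneg (by linarith) (sq_nonneg _)
    have e2 : 0 ≤ (1 - (k₂ ^ 2 + E₂ ^ 2)) * x 1 ^ 2 := mul_nonneg (by linarith) (sq_nonneg _)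
    have e3 := sq_nonneg (E₁ * x 0 + E₂ * x 1 + x 2 + b * x 3)
    have e4 := sq_nonneg (k₁ * x 0 + k₂ * x 1 + s * x 3)
    have e5 : s ^ 2 * x 3 ^ 2 = (1 - b ^ 2) * x 3 ^ 2 := by rw [hs]
    linarith

theorem qs_abs {d : ℕ} {M : Matrix (Fin d) (Fin d) ℂ} (h1 : (1 - M).PosSemidef)
    (h2 : (1 + M).PosSemidef) {v : Fin d → ℂ} (hv : (∑ i, Complex.normSq (v i)) = 1) :
    (star v ⬝ᵥ M.mulVec v).re ^ 2 ≤ 1 := by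
  have hvv : star v ⬝ᵥ v = 1 := by
    simp only [dotProduct, Pi.star_apply, Complex.star_def, ← Complex.normSq_eq_conj_mul_self]
    exact_mod_cast hv
  have a1 := (Complex.le_def.mp (h1.dotProduct_mulVec_nonneg v)).1
  have a2 := (Complex.le_def.mp (h2.dotProduct_mulVec_nonneg v)).1
  rw [Matrix.sub_mulVec, dotProduct_sub, Matrix.one_mulVec, hvv] at a1
  rw [Matrix.add_mulVec, dotProduct_add, Matrix.one_mulVec, hvv] at a2
  simp at a1 a2
  rw [sq_le_one_iff_abs_le_one, abs_le]
  constructor <;> linarith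

theorem qs_absE {d : ℕ} {M ρ : Matrix (Fin d) (Fin d) ℂ} {E : ℝ} (h1 : (1 - M).PosSemidef)
    (h2 : (1 + M).PosSemidef) (hρ : ρ.PosSemidef) (hρ1 : ρ.trace = 1)
    (hE : (ρ * M).trace = (E : ℂ)) : E ^ 2 ≤ 1 := by
  obtain ⟨m, w, hw⟩ := qs_decomp hρ
  have hpos : ∀ X : Matrix (Fin d) (Fin d) ℂ, X.PosSemidef → 0 ≤ (ρ * X).trace.re := by
    intro X hX
    rw [hw, qs_trace, Complex.re_sum]
    exact Finset.sum_nonneg fun i _ => (Complex.le_def.mp (hX.dotProduct_mulVec_nonneg (w i))).1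
  have a1 := hpos _ h1
  have a2 := hpos _ h2
  rw [Matrix.mul_sub, Matrix.trace_sub, Matrix.mul_one, hρ1, hE] at a1
  rw [Matrix.mul_add, Matrix.trace_add, Matrix.mul_one, hρ1, hE] at a2
  simp at a1 a2
  rw [sq_le_one_iff_abs_le_one, abs_le]
  constructor <;> linarith

theorem qs_forward {E ω : Fin 2 → ℝ} (h : IsQuantumRep E ω) :
    ∃ u v η₁ η₂ : ℝ, η₁ ≤ ω 0 ∧ η₂ ≤ ω 1 ∧
        (!![(1:ℝ), u, E 0, 2 * η₁ - 1;
            u, 1, E 1, 2 * η₂ - 1;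
            E 0, E 1, 1, v;
            2 * η₁ - 1, 2 * η₂ - 1, v, 1]).PosSemidef := by
  obtain ⟨d, ρ, M, O, v, hρ, hρ1, -, h1, h2, -, -, hv, hO, hE, hω⟩ := h
  have ha := qs_abs h1 h2 hv
  have hEx : ∀ x, E x ^ 2 ≤ 1 := fun x => qs_absE h1 h2 (hρ x) (hρ1 x) (hE x)
  have key : ∀ x, ∃ η : ℝ, η ≤ ω x ∧ (2 * η - 1 - (-(star v ⬝ᵥ M.mulVec v).re) * E x) ^ 2
      ≤ (1 - (-(star v ⬝ᵥ M.mulVec v).re) ^ 2) * (1 - E x ^ 2) := by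
    intro x
    obtain ⟨F, hF, hF2⟩ := qs_state (hρ x) (hρ1 x) h1 h2 hv hO (hE x) (hω x)
    exact qs_real hF hF2 (hEx x) ha
  obtain ⟨η₁, l₁, q₁⟩ := key 0
  obtain ⟨η₂, l₂, q₂⟩ := key 1
  obtain ⟨u, hu⟩ := qs_gram (by rw [neg_sq]; exact ha) (hEx 0) (hEx 1) q₁ q₂
  exact ⟨u, _, η₁, η₂, l₁, l₂, hu⟩

theorem qs_psd2 {a b c : ℝ} (ha : 0 ≤ a) (hc : 0 ≤ c) (h : b ^ 2 ≤ a * c) :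
    (!![(a:ℂ), (b:ℂ); (b:ℂ), (c:ℂ)]).PosSemidef := by
  refine Matrix.PosSemidef.of_dotProduct_mulVec_nonneg ?_ ?_
  · ext i j; fin_cases i <;> fin_cases j <;> simp
  · intro x
    have hreal : ∀ p q : ℝ, 0 ≤ a * p ^ 2 + 2 * b * (p * q) + c * q ^ 2 := by
      intro p q
      rcases ha.eq_or_lt with h0 | h0
      · have : b = 0 := by
          have : b ^ 2 = 0 := le_antisymm (by rw [← h0] at h; linarith) (sq_nonneg _)
          exact pow_eq_zero_iff (two_ne_zero) |>.mp this
        rw [this]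
        have := mul_nonneg ha (sq_nonneg p)
        have := mul_nonneg hc (sq_nonneg q)
        linarith
      · have h1 : 0 ≤ a * (a * p ^ 2 + 2 * b * (p * q) + c * q ^ 2) := by
          have := mul_nonneg (sub_nonneg.mpr h) (sq_nonneg q)
          have := sq_nonneg (a * p + b * q)
          nlinarith
        exact nonneg_of_mul_nonneg_right h1 h0
    have k1 := hreal (x 0).re (x 1).re
    have k2 := hreal (x 0).im (x 1).im
    rw [Complex.le_def]
    simp [Matrix.mulVec, dotProduct, Fin.sum_univ_two]
    constructor
    · nlinarith
    · ring

theorem qs_minor {E c b : ℝ} (h : (!![(1:ℝ), E, c; E, 1, b; c, b, 1]).PosSemidef) :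
    E ^ 2 ≤ 1 ∧ b ^ 2 ≤ 1 ∧ (c - b * E) ^ 2 ≤ (1 - b ^ 2) * (1 - E ^ 2) := by
  have q : ∀ x : Fin 3 → ℝ, _ := fun x => h.dotProduct_mulVec_nonneg x
  simp [Matrix.mulVec, dotProduct, Fin.sum_univ_three] at q
  have q1 := q ![E, -1, 0]
  have q2 := q ![0, b, -1]
  have hd := h.det_nonneg
  rw [Matrix.det_fin_three] at hd
  simp at q1 q2 hd
  refine ⟨by nlinarith, by nlinarith, by nlinarith⟩

theorem qs_backward {E ω : Fin 2 → ℝ} {b : ℝ} (η : Fin 2 → ℝ) (hη : ∀ x, η x ≤ ω x)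
    (hb : b ^ 2 ≤ 1) (hE : ∀ x, E x ^ 2 ≤ 1)
    (h : ∀ x, (2 * η x - 1 - b * E x) ^ 2 ≤ (1 - b ^ 2) * (1 - E x ^ 2)) : IsQuantumRep E ω := by
  obtain ⟨hb1, hb2⟩ := abs_le.mp ((sq_le_one_iff_abs_le_one b).mp hb)
  obtain ⟨p, hp⟩ : ∃ p : ℝ, p ^ 2 = (1 - b) / 2 := ⟨_, Real.sq_sqrt (by linarith)⟩
  obtain ⟨q, hq⟩ : ∃ q : ℝ, q ^ 2 = (1 + b) / 2 := ⟨_, Real.sq_sqrt (by linarith)⟩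
  have hs : (2 * p * q) ^ 2 = 1 - b ^ 2 := by
    rw [mul_pow, mul_pow, hp, hq]; ring
  choose k hk hn using fun x => qs_coord (h x) (hE x) hs
  have hEa : ∀ x, -1 ≤ E x ∧ E x ≤ 1 := fun x =>
    abs_le.mp ((sq_le_one_iff_abs_le_one (E x)).mp (hE x))
  have e1 : p * p + q * q = 1 := by nlinarith
  refine ⟨2, fun x => !![(((1 + E x) / 2 : ℝ) : ℂ), ((k x / 2 : ℝ) : ℂ);
      ((k x / 2 : ℝ) : ℂ), (((1 - E x) / 2 : ℝ) : ℂ)],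
    !![1, 0; 0, -1],
    !![((q * q : ℝ) : ℂ), ((p * q : ℝ) : ℂ); ((p * q : ℝ) : ℂ), ((p * p : ℝ) : ℂ)],
    ![(p : ℂ), -(q : ℂ)], ?_, ?_, ?_, ?_, ?_, ?_, ?_, ?_, ?_, ?_, ?_⟩
  · intro x
    have := hEa x
    have := hn x
    exact qs_psd2 (by linarith) (by linarith) (by nlinarith)
  · intro x
    rw [Matrix.trace_fin_two]
    simp
    ring
  · ext i j; fin_cases i <;> fin_cases j <;> simp
  · convert qs_psd2 (a := 0) (b := 0) (c := 2) le_rfl (by norm_num) (by norm_num) using 1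
    ext i j; fin_cases i <;> fin_cases j <;> norm_num
  · convert qs_psd2 (a := 2) (b := 0) (c := 0) (by norm_num) le_rfl (by norm_num) using 1
    ext i j; fin_cases i <;> fin_cases j <;> norm_num
  · ext i j; fin_cases i <;> fin_cases j <;> simp
  · ext i; fin_cases i <;> simp <;> ring
  · simp [Fin.sum_univ_two]
    exact e1
  · convert Matrix.PosSemidef.zero using 1
    have e2 : (p : ℂ) * p + q * q = 1 := by exact_mod_cast e1
    ext i j
    rw [Matrix.sub_apply, Matrix.sub_apply, Matrix.vecMulVec_apply]
    fin_cases i <;> fin_cases j <;> simp <;> first | linear_combination e2 | ring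
  · intro x
    rw [Matrix.trace_fin_two]
    simp
    ring
  · intro x
    refine le_trans (le_of_eq ?_) (hη x)
    have := hk x
    rw [Matrix.trace_fin_two]
    simp [Matrix.mul_apply, Fin.sum_univ_two]
    linear_combination (1 / 2) * hk x + (1 + E x) / 2 * hq + (1 - E x) / 2 * hp

theorem qs_convex : Convex ℝ {b : (Fin 2 → ℝ) × (Fin 2 → ℝ) |
    ∃ u v η₁ η₂ : ℝ, η₁ ≤ b.2 0 ∧ η₂ ≤ b.2 1 ∧
        (!![(1:ℝ), u, b.1 0, 2 * η₁ - 1;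
            u, 1, b.1 1, 2 * η₂ - 1;
            b.1 0, b.1 1, 1, v;
            2 * η₁ - 1, 2 * η₂ - 1, v, 1]).PosSemidef} := by
  rintro ⟨E, ω⟩ ⟨u, v, η₁, η₂, l₁, l₂, h⟩ ⟨E', ω'⟩ ⟨u', v', η₁', η₂', l₁', l₂', h'⟩ r s hr hs hrs
  refine ⟨r * u + s * u', r * v + s * v', r * η₁ + s * η₁', r * η₂ + s * η₂', ?_, ?_, ?_⟩
  · have := mul_le_mul_of_nonneg_left l₁ hr
    have := mul_le_mul_of_nonneg_left l₁' hs
    simp at *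
    linarith
  · have := mul_le_mul_of_nonneg_left l₂ hr
    have := mul_le_mul_of_nonneg_left l₂' hs
    simp at *
    linarith
  · convert (h.smul hr).add (h'.smul hs) using 1
    ext i j
    fin_cases i <;> fin_cases j <;> simp <;> linarith

/-- Theorem 1 (SDP characterization of the quantum set). -/
theorem behaviour_mem_quantumSet_iff_sdp (E ω : Fin 2 → ℝ) :
    (E, ω) ∈ QuantumSet ↔
      ∃ u v η₁ η₂ : ℝ, η₁ ≤ ω 0 ∧ η₂ ≤ ω 1 ∧
        (!![(1:ℝ), u, E 0, 2 * η₁ - 1;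
            u, 1, E 1, 2 * η₂ - 1;
            E 0, E 1, 1, v;
            2 * η₁ - 1, 2 * η₂ - 1, v, 1]).PosSemidef := by
  constructor
  · intro h
    exact convexHull_min (fun b hb => qs_forward hb) qs_convex h
  · rintro ⟨u, b, η₁, η₂, l₁, l₂, h⟩
    refine subset_convexHull ℝ _ ?_
    have m1 : (!![(1:ℝ), E 0, 2 * η₁ - 1; E 0, 1, b; 2 * η₁ - 1, b, 1]).PosSemidef := by
      convert h.submatrix ![0, 2, 3] using 1
      ext i j; fin_cases i <;> fin_cases j <;> rfl
    have m2 : (!![(1:ℝ), E 1, 2 * η₂ - 1; E 1, 1, b; 2 * η₂ - 1, b, 1]).PosSemidef := by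
      convert h.submatrix ![1, 2, 3] using 1
      ext i j; fin_cases i <;> fin_cases j <;> rfl
    obtain ⟨hE1, hb, k1⟩ := qs_minor m1
    obtain ⟨hE2, -, k2⟩ := qs_minor m2
    refine qs_backward (b := b) ![η₁, η₂] ?_ hb ?_ ?_
    · intro x; fin_cases x <;> simpa
    · intro x; fin_cases x <;> assumption
    · intro x; fin_cases x <;> simpa

end
end

section
/- Let (E₁,E₂,ω₁,ω₂) satisfy −1 ≤ Eₓ ≤ 1 and ωₓ ≥ 0 for x = 1,2, and ω₁ + ω₂ ≤ 1. Then (E₁,E₂,ω₁,ω₂) belongs to the quantum set Q if and only if |arcsin E₁ − arcsin E₂| ≤ 2(arcsin √ω₁ + arcsin √ω₂). -/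
open scoped ComplexOrder

noncomputable section

/-- Triangle inequality for arccos of inner products of unit vectors. -/
lemma qs_arccos_ineq {V : Type*} [NormedAddCommGroup V] [InnerProductSpace ℝ V]
    (u w m z : V) (hu : ‖u‖ = 1) (hw : ‖w‖ = 1) (hm : ‖m‖ = 1) (hz : ‖z‖ = 1) :
    |Real.arccos (inner ℝ u m) - Real.arccos (inner ℝ w m)| ≤
      Real.arccos (inner ℝ u z) + Real.arccos (inner ℝ w z) := by
  have key : ∀ a b : V, ‖a‖ = 1 → ‖b‖ = 1 →
      InnerProductGeometry.angle a b = Real.arccos (inner ℝ a b) := by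
    intro a b ha hb
    simp [InnerProductGeometry.angle, ha, hb]
  rw [← key u m hu hm, ← key w m hw hm, ← key u z hu hz, ← key w z hw hz]
  have h1 := InnerProductGeometry.angle_le_angle_add_angle u z m
  have h2 := InnerProductGeometry.angle_le_angle_add_angle z w m
  have h3 := InnerProductGeometry.angle_le_angle_add_angle w z m
  have h4 := InnerProductGeometry.angle_le_angle_add_angle z u m
  rw [InnerProductGeometry.angle_comm z w] at h2
  rw [InnerProductGeometry.angle_comm z u] at h4
  rw [abs_le]
  constructor <;> linarith

/-- The closed form of the set. -/
def QSClosed : Set ((Fin 2 → ℝ) × (Fin 2 → ℝ)) :=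
  {b | (∀ x, -1 ≤ b.1 x ∧ b.1 x ≤ 1) ∧ (∀ x, 0 ≤ b.2 x) ∧
    |Real.arccos (b.1 0) - Real.arccos (b.1 1)| ≤
      Real.arccos (1 - 2 * b.2 0) + Real.arccos (1 - 2 * b.2 1)}

lemma qs_cos_ge (α ζ w : ℝ) (hw : 0 ≤ w) (h : |α - ζ| ≤ Real.arccos (1 - 2 * w)) :
    1 - 2 * w ≤ Real.cos (α - ζ) := by
  rcases le_or_gt (-1) (1 - 2 * w) with h1 | h1
  · rw [← Real.cos_abs (α - ζ)]
    calc 1 - 2 * w = Real.cos (Real.arccos (1 - 2 * w)) := by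
          rw [Real.cos_arccos h1 (by linarith)]
      _ ≤ _ := Real.cos_le_cos_of_nonneg_of_le_pi (abs_nonneg _) (Real.arccos_le_pi _) h
  · linarith [Real.neg_one_le_cos (α - ζ)]

lemma qs_exists_angle (b : (Fin 2 → ℝ) × (Fin 2 → ℝ)) (hb : b ∈ QSClosed) :
    ∃ ζ : ℝ, ∀ x, 1 - 2 * b.2 x ≤ Real.cos (Real.arccos (b.1 x) - ζ) := by
  obtain ⟨_, h2, h3⟩ := hb
  have p0 := Real.arccos_nonneg (1 - 2 * b.2 0)
  have p1 := Real.arccos_nonneg (1 - 2 * b.2 1)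
  have : ∃ ζ : ℝ, |Real.arccos (b.1 0) - ζ| ≤ Real.arccos (1 - 2 * b.2 0) ∧
      |Real.arccos (b.1 1) - ζ| ≤ Real.arccos (1 - 2 * b.2 1) := by
    rw [abs_le] at h3
    generalize Real.arccos (b.1 0) = α at *
    generalize Real.arccos (b.1 1) = β at *
    rcases le_total α β with h | h
    · rcases le_total (α + Real.arccos (1 - 2 * b.2 0)) β with h' | h'
      · refine ⟨α + Real.arccos (1 - 2 * b.2 0), ?_, ?_⟩ <;> rw [abs_le] <;> constructor <;> linarith
      · refine ⟨β, ?_, ?_⟩ <;> rw [abs_le] <;> constructor <;> linarith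
    · rcases le_total β (α - Real.arccos (1 - 2 * b.2 0)) with h' | h'
      · refine ⟨α - Real.arccos (1 - 2 * b.2 0), ?_, ?_⟩ <;> rw [abs_le] <;> constructor <;> linarith
      · refine ⟨β, ?_, ?_⟩ <;> rw [abs_le] <;> constructor <;> linarith
  obtain ⟨ζ, z0, z1⟩ := this
  refine ⟨ζ, fun x => ?_⟩
  fin_cases x
  · exact qs_cos_ge _ _ _ (h2 0) z0
  · exact qs_cos_ge _ _ _ (h2 1) z1

/-- Unit vector in the plane. -/
def qsVec (θ : ℝ) : ℂ := ⟨Real.cos θ, Real.sin θ⟩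

lemma qsVec_inner (θ η : ℝ) : inner ℝ (qsVec θ) (qsVec η) = Real.cos (θ - η) := by
  simp [Complex.inner, qsVec, Real.cos_sub]
  try ring

/-- Superposition of two planar vectors. -/
def qsSum (s t θ η : ℝ) : WithLp 2 (ℂ × ℂ) :=
  WithLp.toLp 2 (Real.sqrt s • qsVec θ, Real.sqrt t • qsVec η)

lemma qsSum_inner (s t : ℝ) (hs : 0 ≤ s) (ht : 0 ≤ t) (θ η θ' η' : ℝ) :
    inner ℝ (qsSum s t θ η) (qsSum s t θ' η') =
      s * Real.cos (θ - θ') + t * Real.cos (η - η') := by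
  rw [WithLp.prod_inner_apply]
  simp only [qsSum]
  rw [real_inner_smul_left, real_inner_smul_right, real_inner_smul_left, real_inner_smul_right,
    qsVec_inner, qsVec_inner, ← mul_assoc, ← mul_assoc, Real.mul_self_sqrt hs,
    Real.mul_self_sqrt ht]

lemma qsSum_norm (s t : ℝ) (hs : 0 ≤ s) (ht : 0 ≤ t) (hst : s + t = 1) (θ η : ℝ) :
    ‖qsSum s t θ η‖ = 1 := by
  have h := real_inner_self_eq_norm_sq (qsSum s t θ η)
  rw [qsSum_inner s t hs ht] at h
  simp only [sub_self, Real.cos_zero, mul_one, hst] at h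
  nlinarith [norm_nonneg (qsSum s t θ η)]

lemma qsClosed_convex : Convex ℝ QSClosed := by
  intro b hb c hc s t hs ht hst
  obtain ⟨ζ, hζ⟩ := qs_exists_angle b hb
  obtain ⟨ξ, hξ⟩ := qs_exists_angle c hc
  obtain ⟨b1, b2, -⟩ := hb
  obtain ⟨c1, c2, -⟩ := hc
  have e1 : ∀ x, (s • b + t • c).1 x = s * b.1 x + t * c.1 x := fun x => by simp
  have e2 : ∀ x, (s • b + t • c).2 x = s * b.2 x + t * c.2 x := fun x => by simp
  refine ⟨fun x => ?_, fun x => ?_, ?_⟩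
  · rw [e1]
    have := b1 x
    have := c1 x
    constructor <;> nlinarith
  · rw [e2]
    have := b2 x
    have := c2 x
    positivity
  · have key := qs_arccos_ineq
      (qsSum s t (Real.arccos (b.1 0)) (Real.arccos (c.1 0)))
      (qsSum s t (Real.arccos (b.1 1)) (Real.arccos (c.1 1)))
      (qsSum s t 0 0) (qsSum s t ζ ξ) (qsSum_norm s t hs ht hst _ _) (qsSum_norm s t hs ht hst _ _)
      (qsSum_norm s t hs ht hst _ _) (qsSum_norm s t hs ht hst _ _)
    simp only [qsSum_inner s t hs ht, sub_zero] at key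
    rw [Real.cos_arccos (b1 0).1 (b1 0).2, Real.cos_arccos (b1 1).1 (b1 1).2,
      Real.cos_arccos (c1 0).1 (c1 0).2, Real.cos_arccos (c1 1).1 (c1 1).2] at key
    simp only [e1, e2]
    refine key.trans (add_le_add ?_ ?_)
    · apply Real.arccos_le_arccos
      nlinarith [mul_le_mul_of_nonneg_left (hζ 0) hs, mul_le_mul_of_nonneg_left (hξ 0) ht]
    · apply Real.arccos_le_arccos
      nlinarith [mul_le_mul_of_nonneg_left (hζ 1) hs, mul_le_mul_of_nonneg_left (hξ 1) ht]

section frob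

attribute [local instance] Matrix.frobeniusNormedAddCommGroup Matrix.frobeniusNormedSpace

lemma qs_frob_sq {m n : Type*} [Fintype m] [Fintype n] (A : Matrix m n ℂ) :
    ‖A‖ ^ 2 = (A.conjTranspose * A).trace.re := by
  rw [Matrix.frobenius_norm_def, ← Real.sqrt_eq_rpow, Real.sq_sqrt (by positivity)]
  simp only [Matrix.trace, Matrix.diag, Matrix.mul_apply, Matrix.conjTranspose_apply,
    Complex.re_sum]
  rw [Finset.sum_comm]
  refine Finset.sum_congr rfl fun j _ => Finset.sum_congr rfl fun i _ => ?_
  rw [Real.rpow_two, ← Complex.normSq_eq_norm_sq, Complex.normSq_apply]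
  simp

lemma qs_factor {d : ℕ} (A : Matrix (Fin d) (Fin d) ℂ) (h : A.PosSemidef) :
    ∃ B : Matrix (Fin d) (Fin d) ℂ, A = B.conjTranspose * B := by
  open scoped MatrixOrder in
  exact CStarAlgebra.nonneg_iff_eq_star_mul_self.mp h.nonneg

set_option maxHeartbeats 2000000 in
lemma qs_fidelity {d : ℕ} (ρ M : Matrix (Fin d) (Fin d) ℂ) (V : Matrix (Fin d) Unit ℂ)
    (hρ : ρ.PosSemidef) (hM1 : (1 - M).PosSemidef) (hM2 : (1 + M).PosSemidef)
    (hρ1 : ρ.trace = 1) (hV : (V.conjTranspose * V).trace = 1) :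
    let p := (V.conjTranspose * ρ * V).trace.re
    let e := (ρ * M).trace.re
    let e' := (V.conjTranspose * M * V).trace.re
    0 ≤ p ∧ -1 ≤ e ∧ e ≤ 1 ∧ -1 ≤ e' ∧ e' ≤ 1 ∧
    2 * p ≤ (Real.sqrt (1 + e') * Real.sqrt (1 + e) + Real.sqrt (1 - e') * Real.sqrt (1 - e)) *
      Real.sqrt p := by
  intro p e e'
  obtain ⟨B, hB⟩ := qs_factor ρ hρ
  obtain ⟨C, hC⟩ := qs_factor _ hM2
  obtain ⟨D, hD⟩ := qs_factor _ hM1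
  have nW : ‖B * V‖ ^ 2 = p := by
    rw [qs_frob_sq]
    simp only [p, hB, Matrix.conjTranspose_mul, Matrix.mul_assoc]
  have nCV : ‖C * V‖ ^ 2 = 1 + e' := by
    rw [qs_frob_sq, Matrix.conjTranspose_mul]
    have : V.conjTranspose * C.conjTranspose * (C * V) =
        V.conjTranspose * V + V.conjTranspose * M * V := by
      calc _ = V.conjTranspose * (C.conjTranspose * C) * V := by simp only [Matrix.mul_assoc]
        _ = _ := by rw [← hC, Matrix.mul_add, Matrix.add_mul, Matrix.mul_one]
    rw [this, Matrix.trace_add, hV]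
    simp [e']
  have nDV : ‖D * V‖ ^ 2 = 1 - e' := by
    rw [qs_frob_sq, Matrix.conjTranspose_mul]
    have : V.conjTranspose * D.conjTranspose * (D * V) =
        V.conjTranspose * V - V.conjTranspose * M * V := by
      calc _ = V.conjTranspose * (D.conjTranspose * D) * V := by simp only [Matrix.mul_assoc]
        _ = _ := by rw [← hD, Matrix.mul_sub, Matrix.sub_mul, Matrix.mul_one]
    rw [this, Matrix.trace_sub, hV]
    simp [e']
  have nCB : ‖C * B.conjTranspose‖ ^ 2 = 1 + e := by
    rw [qs_frob_sq, Matrix.conjTranspose_mul, Matrix.conjTranspose_conjTranspose]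
    have : (B * C.conjTranspose * (C * B.conjTranspose)).trace = (ρ * (1 + M)).trace := by
      rw [hC, hB]
      calc _ = (B * (C.conjTranspose * C * B.conjTranspose)).trace := by
            simp only [Matrix.mul_assoc]
        _ = _ := by rw [Matrix.trace_mul_comm, Matrix.mul_assoc, Matrix.trace_mul_comm]
    rw [this, Matrix.mul_add, Matrix.trace_add, Matrix.mul_one, hρ1]
    simp [e]
  have nDB : ‖D * B.conjTranspose‖ ^ 2 = 1 - e := by
    rw [qs_frob_sq, Matrix.conjTranspose_mul, Matrix.conjTranspose_conjTranspose]
    have : (B * D.conjTranspose * (D * B.conjTranspose)).trace = (ρ * (1 - M)).trace := by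
      rw [hD, hB]
      calc _ = (B * (D.conjTranspose * D * B.conjTranspose)).trace := by
            simp only [Matrix.mul_assoc]
        _ = _ := by rw [Matrix.trace_mul_comm, Matrix.mul_assoc, Matrix.trace_mul_comm]
    rw [this, Matrix.mul_sub, Matrix.trace_sub, Matrix.mul_one, hρ1]
    simp [e]
  have hdecomp : (2 : ℝ) • (V.conjTranspose * ρ * V) =
      (C * V).conjTranspose * ((C * B.conjTranspose) * (B * V)) +
      (D * V).conjTranspose * ((D * B.conjTranspose) * (B * V)) := by
    have h1 : (C * V).conjTranspose * ((C * B.conjTranspose) * (B * V)) =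
        V.conjTranspose * ((1 + M) * (ρ * V)) := by
      rw [hC, hB]; simp only [Matrix.conjTranspose_mul, Matrix.mul_assoc]
    have h2 : (D * V).conjTranspose * ((D * B.conjTranspose) * (B * V)) =
        V.conjTranspose * ((1 - M) * (ρ * V)) := by
      rw [hD, hB]; simp only [Matrix.conjTranspose_mul, Matrix.mul_assoc]
    rw [h1, h2, ← Matrix.mul_add, ← Matrix.add_mul]
    have : (1 + M) + (1 - M) = (2 : ℝ) • (1 : Matrix (Fin d) (Fin d) ℂ) := by
      rw [two_smul]; abel
    rw [this]
    simp [Matrix.mul_assoc]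
  have hle : 2 * p ≤ ‖(2 : ℝ) • (V.conjTranspose * ρ * V)‖ := by
    rw [norm_smul]
    have h1 : p ≤ ‖V.conjTranspose * ρ * V‖ := by
      have h2 := qs_frob_sq (V.conjTranspose * ρ * V)
      have h3 : ((V.conjTranspose * ρ * V).conjTranspose * (V.conjTranspose * ρ * V)).trace.re
          = Complex.normSq (V.conjTranspose * ρ * V).trace := by
        generalize V.conjTranspose * ρ * V = X
        simp [Matrix.trace, Matrix.mul_apply, Complex.normSq_apply]
      rw [h3, Complex.normSq_apply] at h2
      apply le_of_sq_le_sq _ (norm_nonneg _)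
      rw [h2]
      nlinarith [mul_self_nonneg (V.conjTranspose * ρ * V).trace.im]
    simpa using h1
  have sW : Real.sqrt p = ‖B * V‖ := by rw [← nW, Real.sqrt_sq (norm_nonneg _)]
  have sCV : Real.sqrt (1 + e') = ‖C * V‖ := by rw [← nCV, Real.sqrt_sq (norm_nonneg _)]
  have sDV : Real.sqrt (1 - e') = ‖D * V‖ := by rw [← nDV, Real.sqrt_sq (norm_nonneg _)]
  have sCB : Real.sqrt (1 + e) = ‖C * B.conjTranspose‖ := by
    rw [← nCB, Real.sqrt_sq (norm_nonneg _)]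
  have sDB : Real.sqrt (1 - e) = ‖D * B.conjTranspose‖ := by
    rw [← nDB, Real.sqrt_sq (norm_nonneg _)]
  refine ⟨by rw [← nW]; positivity, by nlinarith [sq_nonneg ‖C * B.conjTranspose‖],
    by nlinarith [sq_nonneg ‖D * B.conjTranspose‖], by nlinarith [sq_nonneg ‖C * V‖],
    by nlinarith [sq_nonneg ‖D * V‖], ?_⟩
  rw [sW, sCV, sDV, sCB, sDB]
  refine hle.trans ?_
  rw [hdecomp]
  refine (norm_add_le _ _).trans ?_
  have b1 : ‖(C * V).conjTranspose * ((C * B.conjTranspose) * (B * V))‖ ≤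
      ‖C * V‖ * (‖C * B.conjTranspose‖ * ‖B * V‖) := by
    refine (Matrix.frobenius_norm_mul _ _).trans ?_
    rw [Matrix.frobenius_norm_conjTranspose]
    exact mul_le_mul_of_nonneg_left (Matrix.frobenius_norm_mul _ _) (norm_nonneg _)
  have b2 : ‖(D * V).conjTranspose * ((D * B.conjTranspose) * (B * V))‖ ≤
      ‖D * V‖ * (‖D * B.conjTranspose‖ * ‖B * V‖) := by
    refine (Matrix.frobenius_norm_mul _ _).trans ?_
    rw [Matrix.frobenius_norm_conjTranspose]
    exact mul_le_mul_of_nonneg_left (Matrix.frobenius_norm_mul _ _) (norm_nonneg _)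
  linarith

end frob

lemma qs_arccos_of_fidelity (p e e' : ℝ) (hp : 0 ≤ p) (h1 : -1 ≤ e) (h2 : e ≤ 1)
    (h3 : -1 ≤ e') (h4 : e' ≤ 1)
    (h : 2 * p ≤ (Real.sqrt (1 + e') * Real.sqrt (1 + e) +
      Real.sqrt (1 - e') * Real.sqrt (1 - e)) * Real.sqrt p) :
    |Real.arccos e - Real.arccos e'| ≤ Real.arccos (2 * p - 1) := by
  have hcos : 2 * p - 1 ≤ Real.cos (Real.arccos e - Real.arccos e') := by
    rw [Real.cos_sub, Real.cos_arccos h1 h2, Real.cos_arccos h3 h4, Real.sin_arccos,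
      Real.sin_arccos]
    have f1 : 1 - e ^ 2 = (1 + e) * (1 - e) := by ring
    have f2 : 1 - e' ^ 2 = (1 + e') * (1 - e') := by ring
    rw [f1, f2, Real.sqrt_mul (by linarith), Real.sqrt_mul (by linarith)]
    have sa := Real.sq_sqrt (show 0 ≤ 1 + e by linarith)
    have sb := Real.sq_sqrt (show 0 ≤ 1 - e by linarith)
    have sc := Real.sq_sqrt (show 0 ≤ 1 + e' by linarith)
    have sd := Real.sq_sqrt (show 0 ≤ 1 - e' by linarith)
    have sp := Real.sq_sqrt hp
    have na := Real.sqrt_nonneg (1 + e)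
    have nb := Real.sqrt_nonneg (1 - e)
    have nc := Real.sqrt_nonneg (1 + e')
    have nd := Real.sqrt_nonneg (1 - e')
    have np := Real.sqrt_nonneg p
    generalize Real.sqrt (1 + e) = a at *
    generalize Real.sqrt (1 - e) = b at *
    generalize Real.sqrt (1 + e') = c at *
    generalize Real.sqrt (1 - e') = f at *
    generalize Real.sqrt p = r at *
    have hr : 2 * r ≤ c * a + f * b := by
      rcases np.eq_or_lt with h0 | h0
      · rw [← h0]; nlinarith [mul_nonneg nc na, mul_nonneg nd nb]
      · have : 2 * r * r ≤ (c * a + f * b) * r := by nlinarith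
        exact le_of_mul_le_mul_right this h0
    have hsq : (2 * r) ^ 2 ≤ (c * a + f * b) ^ 2 := by gcongr
    have hx : (c * a + f * b) ^ 2 = (1 + e') * (1 + e) + (1 - e') * (1 - e)
        + 2 * (a * b * (c * f)) := by
      rw [← sa, ← sb, ← sc, ← sd]; ring
    nlinarith
  have hle : |Real.arccos e - Real.arccos e'| ≤ Real.pi := by
    rw [abs_le]
    have := Real.arccos_nonneg e
    have := Real.arccos_nonneg e'
    have := Real.arccos_le_pi e
    have := Real.arccos_le_pi e'
    constructor <;> linarith
  rw [← Real.arccos_cos (abs_nonneg _) hle, Real.cos_abs]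
  exact Real.arccos_le_arccos hcos

lemma qs_trace_mul_nonneg {d : ℕ} (A B : Matrix (Fin d) (Fin d) ℂ) (hA : A.PosSemidef)
    (hB : B.PosSemidef) : 0 ≤ (A * B).trace.re := by
  obtain ⟨C, hC⟩ := qs_factor A hA
  have h := (hB.mul_mul_conjTranspose_same C).trace_nonneg
  rw [Matrix.trace_mul_comm, ← Matrix.mul_assoc, ← hC] at h
  exact (Complex.le_def.mp h).1

lemma qs_rep_subset (E ω : Fin 2 → ℝ) (h : IsQuantumRep E ω) : (E, ω) ∈ QSClosed := by
  obtain ⟨d, ρ, M, O, v, hρ, hρ1, -, hM1, hM2, -, -, hv, hO, hE, hω⟩ := h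
  set V : Matrix (Fin d) Unit ℂ := Matrix.replicateCol Unit v with hVdef
  have hVV : V * V.conjTranspose = Matrix.vecMulVec v (star v) := by
    ext i j; simp [hVdef, Matrix.mul_apply, Matrix.vecMulVec_apply]
  have hV : (V.conjTranspose * V).trace = 1 := by
    have : (V.conjTranspose * V).trace = ((∑ i, Complex.normSq (v i) : ℝ) : ℂ) := by
      simp [hVdef, Matrix.trace, Matrix.mul_apply, Complex.normSq_eq_conj_mul_self]
    rw [this, hv]; simp
  have fid := fun x => qs_fidelity (ρ x) M V (hρ x) hM1 hM2 (hρ1 x) hV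
  have hEe : ∀ x, (ρ x * M).trace.re = E x := fun x => by rw [hE x]; simp
  have hp : ∀ x, 1 - (V.conjTranspose * ρ x * V).trace.re ≤ ω x := by
    intro x
    have h1 := qs_trace_mul_nonneg _ _ (hρ x) hO
    have h2 : (V.conjTranspose * ρ x * V).trace = (ρ x * Matrix.vecMulVec v (star v)).trace := by
      rw [Matrix.mul_assoc, Matrix.trace_mul_comm, Matrix.mul_assoc, hVV]
    rw [h2]
    rw [Matrix.mul_sub, Matrix.mul_sub, Matrix.mul_one, Matrix.trace_sub, Matrix.trace_sub,
      hρ1 x] at h1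
    simp only [Complex.sub_re, Complex.one_re] at h1
    linarith [hω x]
  have hang : ∀ x, |Real.arccos (E x) - Real.arccos (V.conjTranspose * M * V).trace.re| ≤
      Real.arccos (1 - 2 * ω x) := by
    intro x
    obtain ⟨f1, f2, f3, f4, f5, f6⟩ := fid x
    rw [hEe x] at f2 f3 f6
    refine (qs_arccos_of_fidelity _ _ _ f1 f2 f3 f4 f5 f6).trans ?_
    apply Real.arccos_le_arccos
    linarith [hp x]
  refine ⟨fun x => ?_, fun x => ?_, ?_⟩
  · obtain ⟨f1, f2, f3, -⟩ := fid x
    rw [hEe x] at f2 f3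
    exact ⟨f2, f3⟩
  · obtain ⟨f1, f2, f3, f4, f5, f6⟩ := fid x
    by_contra hneg
    have hpgt : 1 < (V.conjTranspose * ρ x * V).trace.re := by
      have := hp x
      simp only [not_le] at hneg
      linarith
    have h7 := qs_fidelity (ρ x) 1 V (hρ x) (by simpa using Matrix.PosSemidef.zero)
      (Matrix.PosSemidef.one.add Matrix.PosSemidef.one) (hρ1 x) hV
    obtain ⟨-, -, -, -, -, h7⟩ := h7
    simp only [Matrix.mul_one, hρ1 x, hV, Complex.one_re, sub_self, Real.sqrt_zero, mul_zero,
      add_zero] at h7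
    rw [Real.mul_self_sqrt (by norm_num)] at h7
    have hs := Real.sq_sqrt f1
    have hn := Real.sqrt_nonneg (V.conjTranspose * ρ x * V).trace.re
    nlinarith
  · have h0 := hang 0
    have h1 := hang 1
    simp only
    rw [abs_le] at *
    constructor <;> linarith

lemma qs_closed_rep (E ω : Fin 2 → ℝ) (h : (E, ω) ∈ QSClosed) : IsQuantumRep E ω := by
  obtain ⟨ζ, hζ⟩ := qs_exists_angle _ h
  obtain ⟨hE, -, -⟩ := h
  simp only at hζ hE
  let ψ : ℝ → Fin 2 → ℂ := fun θ => ![(Real.cos (θ / 2) : ℂ), (Real.sin (θ / 2) : ℂ)]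
  have hψs : ∀ θ, star (ψ θ) = ψ θ := by
    intro θ; ext i; fin_cases i <;> simp [ψ, ← Complex.ofReal_cos, ← Complex.ofReal_sin]
  have hcs : ∀ θ : ℝ, (Real.cos θ : ℂ) * Real.cos θ + (Real.sin θ : ℂ) * Real.sin θ = 1 := by
    intro θ
    have := Real.cos_sq_add_sin_sq θ
    rw [← sq, ← sq]; exact_mod_cast this
  have hdot : ∀ θ η, dotProduct (ψ θ) (ψ η) = (Real.cos (θ / 2 - η / 2) : ℂ) := by
    intro θ η
    simp only [dotProduct, Fin.sum_univ_two, ψ, Real.cos_sub]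
    push_cast
    simp
  have hself : ∀ θ, dotProduct (ψ θ) (ψ θ) = 1 := by intro θ; rw [hdot]; simp
  have hmul : ∀ θ η, (Matrix.vecMulVec (ψ θ) (star (ψ θ)) * Matrix.vecMulVec (ψ η) (star (ψ η))).trace
      = ((Real.cos (θ / 2 - η / 2) ^ 2 : ℝ) : ℂ) := by
    intro θ η
    rw [hψs, hψs, Matrix.vecMulVec_mul_vecMulVec, hdot, Matrix.trace_vecMulVec, dotProduct_smul,
      hdot]
    push_cast; simp [sq]
  have htr : ∀ θ, (Matrix.vecMulVec (ψ θ) (star (ψ θ))).trace = 1 := by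
    intro θ; rw [Matrix.trace_vecMulVec, hψs, hself]
  have hO : (1 - Matrix.vecMulVec (ψ ζ) (star (ψ ζ))).IsHermitian := by
    refine Matrix.isHermitian_one.sub (Matrix.posSemidef_vecMulVec_self_star _).isHermitian
  refine ⟨2, fun x => Matrix.vecMulVec (ψ (Real.arccos (E x))) (star (ψ (Real.arccos (E x)))),
    Matrix.diagonal ![1, -1], 1 - Matrix.vecMulVec (ψ ζ) (star (ψ ζ)), ψ ζ,
    fun x => Matrix.posSemidef_vecMulVec_self_star _, fun x => htr _, ?_, ?_, ?_, hO, ?_, ?_, ?_,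
    fun x => ?_, fun x => ?_⟩
  · rw [Matrix.isHermitian_diagonal_iff]
    intro i; fin_cases i <;> simp [IsSelfAdjoint]
  · rw [← Matrix.diagonal_one, Matrix.diagonal_sub, Matrix.posSemidef_diagonal_iff]
    intro i; fin_cases i <;> norm_num
  · rw [← Matrix.diagonal_one, Matrix.diagonal_add, Matrix.posSemidef_diagonal_iff]
    intro i; fin_cases i <;> norm_num
  · rw [Matrix.sub_mulVec, Matrix.one_mulVec, Matrix.vecMulVec_mulVec, hψs, hself]
    simp
  · have := Real.cos_sq_add_sin_sq (ζ / 2)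
    simp only [Fin.sum_univ_two, ψ, Matrix.cons_val_zero, Matrix.cons_val_one, 
      Complex.normSq_ofReal]
    linarith
  · rw [sub_self]; exact Matrix.PosSemidef.zero
  · have h2 : Real.cos (Real.arccos (E x) / 2) ^ 2 - Real.sin (Real.arccos (E x) / 2) ^ 2 = E x := by
      rw [← Real.cos_two_mul', mul_div_cancel₀ _ (two_ne_zero), Real.cos_arccos (hE x).1 (hE x).2]
    simp only [hψs]
    simp only [Matrix.trace, Matrix.diag, Matrix.mul_diagonal, Fin.sum_univ_two,
      Matrix.vecMulVec_apply, ψ, Matrix.cons_val_zero, Matrix.cons_val_one]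
    have h4 := congrArg (fun r : ℝ => (r : ℂ)) h2
    simp only [Complex.ofReal_sub, Complex.ofReal_pow] at h4
    linear_combination h4
  · rw [Matrix.mul_sub, Matrix.trace_sub, Matrix.mul_one, htr, hmul]
    simp only [Complex.sub_re, Complex.one_re, Complex.ofReal_re]
    rw [Real.cos_sq]
    have h3 : 2 * (Real.arccos (E x) / 2 - ζ / 2) = Real.arccos (E x) - ζ := by ring
    rw [h3]
    linarith [hζ x]

lemma qs_arcsin_sqrt (w : ℝ) (h0 : 0 ≤ w) (h1 : w ≤ 1) :
    Real.arccos (1 - 2 * w) = 2 * Real.arcsin (Real.sqrt w) := by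
  have hs : Real.sqrt w ≤ 1 := Real.sqrt_le_one.mpr h1
  have h : Real.cos (2 * Real.arcsin (Real.sqrt w)) = 1 - 2 * w := by
    rw [Real.cos_two_mul, Real.cos_sq', Real.sin_arcsin (by linarith [Real.sqrt_nonneg w]) hs,
      Real.sq_sqrt h0]
    ring
  rw [← h, Real.arccos_cos]
  · have := Real.arcsin_nonneg.mpr (Real.sqrt_nonneg w)
    linarith
  · have := Real.arcsin_le_pi_div_two (Real.sqrt w)
    linarith

/-- Corollary 2 (trigonometric closed form of the quantum set). -/
theorem mem_quantumSet_iff_arcsin (E ω : Fin 2 → ℝ)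
    (hE : ∀ x, -1 ≤ E x ∧ E x ≤ 1) (hω : ∀ x, 0 ≤ ω x)
    (hsum : ω 0 + ω 1 ≤ 1) :
    (E, ω) ∈ QuantumSet ↔
      |Real.arcsin (E 0) - Real.arcsin (E 1)| ≤
        2 * (Real.arcsin (Real.sqrt (ω 0)) + Real.arcsin (Real.sqrt (ω 1))) := by
  have hset : QuantumSet = QSClosed := by
    apply Set.Subset.antisymm
    · exact convexHull_min (fun b hb => qs_rep_subset b.1 b.2 hb) qsClosed_convex
    · exact fun b hb => subset_convexHull ℝ _ (qs_closed_rep b.1 b.2 hb)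
  rw [hset, mul_add, ← qs_arcsin_sqrt (ω 0) (hω 0) (by linarith [hω 1]),
    ← qs_arcsin_sqrt (ω 1) (hω 1) (by linarith [hω 0])]
  have habs : |Real.arcsin (E 0) - Real.arcsin (E 1)| =
      |Real.arccos (E 0) - Real.arccos (E 1)| := by
    rw [abs_sub_comm]
    congr 1
    simp only [Real.arccos]
    ring
  rw [habs]
  exact ⟨fun h => h.2.2, fun h => ⟨hE, hω, h⟩⟩

end
end

section
/- Let (E₁,E₂,ω₁,ω₂) satisfy −1 ≤ Eₓ ≤ 1 and ωₓ ≥ 0 for x = 1,2, and ω₁ + ω₂ ≤ 1. Then (E₁,E₂,ω₁,ω₂) belongs to the quantum set Q if and only if (1/2)(√(1+E₁)·√(1+E₂) + √(1−E₁)·√(1−E₂)) ≥ √(1−ω₁)·√(1−ω₂) − √(ω₁)·√(ω₂). -/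
open scoped ComplexOrder

noncomputable section

namespace QuantumSetAux

open Real Matrix

def G3 (a b t : ℝ) : Prop := ∀ x y z : ℝ, 0 ≤ x^2+y^2+z^2+2*a*x*y+2*b*x*z+2*t*y*z

lemma sqrt_cos_half {a : ℝ} (h0 : 0 ≤ a) (h1 : a ≤ π) : √((1 + cos a)/2) = cos (a/2) := by
  have : (1 + cos a)/2 = (cos (a/2))^2 := by
    rw [cos_sq]; ring_nf
  rw [this, sqrt_sq (cos_nonneg_of_neg_pi_div_two_le_of_le (by linarith [pi_pos]) (by linarith))]

lemma sqrt_sin_half {a : ℝ} (h0 : 0 ≤ a) (h1 : a ≤ π) : √((1 - cos a)/2) = sin (a/2) := by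
  have : (1 - cos a)/2 = (sin (a/2))^2 := by
    rw [sin_sq_eq_half_sub]; ring_nf
  rw [this, sqrt_sq (sin_nonneg_of_nonneg_of_le_pi (by linarith [pi_pos]) (by linarith [pi_pos]))]

lemma arccos_add_le {x y : ℝ} (h : 0 ≤ x + y) : arccos x + arccos y ≤ π := by
  have := arccos_neg y
  have := arccos_le_arccos (show -y ≤ x by linarith)
  linarith

lemma sqrt_split {s t : ℝ} (hs : 0 ≤ s) : √(2*s) * √(2*t) = 2 * (√s * √t) := by
  have : √2 * √2 = 2 := mul_self_sqrt (by norm_num)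
  rw [sqrt_mul (by norm_num), sqrt_mul (by norm_num)]
  linear_combination (√s * √t) * this

lemma key_iff (E0 E1 w0 w1 : ℝ) (hE0 : -1 ≤ E0 ∧ E0 ≤ 1) (hE1 : -1 ≤ E1 ∧ E1 ≤ 1)
    (hw0 : 0 ≤ w0) (hw1 : 0 ≤ w1) (hs : w0 + w1 ≤ 1) :
    √(1 - w0) * √(1 - w1) - √w0 * √w1 ≤
      (√(1 + E0) * √(1 + E1) + √(1 - E0) * √(1 - E1)) / 2 ↔
    |arccos E0 - arccos E1| ≤ arccos (1 - 2*w0) + arccos (1 - 2*w1) := by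
  have hsum := arccos_add_le (x := 1 - 2*w0) (y := 1-2*w1) (by linarith)
  obtain ⟨g0, hg0⟩ : ∃ g, g = arccos E0 := ⟨_, rfl⟩
  obtain ⟨g1, hg1⟩ : ∃ g, g = arccos E1 := ⟨_, rfl⟩
  obtain ⟨a0, ha0⟩ : ∃ g, g = arccos (1 - 2*w0) := ⟨_, rfl⟩
  obtain ⟨a1, ha1⟩ : ∃ g, g = arccos (1 - 2*w1) := ⟨_, rfl⟩
  have cg0 : cos g0 = E0 := by rw [hg0, cos_arccos hE0.1 hE0.2]
  have cg1 : cos g1 = E1 := by rw [hg1, cos_arccos hE1.1 hE1.2]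
  have ca0 : w0 = (1 - cos a0)/2 := by
    rw [ha0, cos_arccos (by linarith) (by linarith)]; ring
  have ca1 : w1 = (1 - cos a1)/2 := by
    rw [ha1, cos_arccos (by linarith) (by linarith)]; ring
  have b0 : 0 ≤ g0 ∧ g0 ≤ π := by rw [hg0]; exact ⟨arccos_nonneg _, arccos_le_pi _⟩
  have b1 : 0 ≤ g1 ∧ g1 ≤ π := by rw [hg1]; exact ⟨arccos_nonneg _, arccos_le_pi _⟩
  have b2 : 0 ≤ a0 ∧ a0 ≤ π := by rw [ha0]; exact ⟨arccos_nonneg _, arccos_le_pi _⟩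
  have b3 : 0 ≤ a1 ∧ a1 ≤ π := by rw [ha1]; exact ⟨arccos_nonneg _, arccos_le_pi _⟩
  rw [← ha0, ← ha1] at hsum
  rw [← hg0, ← hg1, ← ha0, ← ha1, ← cg0, ← cg1]
  have e1 : 1 - w0 = (1 + cos a0)/2 := by rw [ca0]; ring
  have e2 : 1 - w1 = (1 + cos a1)/2 := by rw [ca1]; ring
  rw [e1, e2, ca0, ca1]
  have f0 : 1 + cos g0 = 2 * ((1 + cos g0)/2) := by ring
  have f1 : 1 + cos g1 = 2 * ((1 + cos g1)/2) := by ring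
  have f2 : 1 - cos g0 = 2 * ((1 - cos g0)/2) := by ring
  have f3 : 1 - cos g1 = 2 * ((1 - cos g1)/2) := by ring
  have q1 : √(1 + cos g0) * √(1 + cos g1) = 2 * (cos (g0/2) * cos (g1/2)) := by
    rw [f0, f1, sqrt_split (by linarith [neg_one_le_cos g0]), sqrt_cos_half b0.1 b0.2,
      sqrt_cos_half b1.1 b1.2]
  have q2 : √(1 - cos g0) * √(1 - cos g1) = 2 * (sin (g0/2) * sin (g1/2)) := by
    rw [f2, f3, sqrt_split (by linarith [cos_le_one g0]), sqrt_sin_half b0.1 b0.2,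
      sqrt_sin_half b1.1 b1.2]
  rw [q1, q2, sqrt_cos_half b2.1 b2.2, sqrt_cos_half b3.1 b3.2, sqrt_sin_half b2.1 b2.2,
    sqrt_sin_half b3.1 b3.2]
  have r : (2 * (cos (g0/2) * cos (g1/2)) + 2 * (sin (g0/2) * sin (g1/2)))/2
      = cos (|g0 - g1|/2) := by
    have : |g0 - g1|/2 = |g0/2 - g1/2| := by
      rw [← sub_div, abs_div]; simp
    rw [this, cos_abs, cos_sub]; ring
  rw [r, ← cos_add]
  have hab : |g0 - g1| ≤ π := abs_le.2 ⟨by linarith, by linarith⟩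
  rw [strictAntiOn_cos.le_iff_ge (by constructor <;> linarith) 
    ⟨by positivity, by linarith [pi_pos]⟩]
  constructor <;> intro h <;> linarith

lemma G3_cos (a b : ℝ) : G3 (cos a) (cos b) (cos (a - b)) := by
  intro x y z
  rw [cos_sub]
  have := sin_sq_add_cos_sq a
  have := sin_sq_add_cos_sq b
  have h : x^2+y^2+z^2+2*cos a*x*y+2*cos b*x*z+2*(cos a * cos b + sin a * sin b)*y*z
    = (x + y * cos a + z * cos b)^2 + (y * sin a + z * sin b)^2 := by
    linear_combination (-y^2) * sin_sq_add_cos_sq a - z^2 * sin_sq_add_cos_sq b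
  rw [h]; positivity

lemma G3_cos' (a b : ℝ) : G3 (cos a) (cos b) (cos (a + b)) := by
  have := G3_cos a (-b)
  simpa using this

lemma G3_sq {a b t : ℝ} (h : G3 a b t) : (t - a*b)^2 ≤ (1-a^2)*(1-b^2) := by
  have h1 : ∀ y : ℝ, 0 ≤ (1-a^2)*(y*y) + (2*(t-a*b))*y + (1-b^2) := by
    intro y
    have := h (-(a*y+b)) y 1
    linarith
  have := discrim_le_zero h1
  unfold discrim at this
  nlinarith

lemma G3_bd {a b t : ℝ} (h : G3 a b t) : (-1 ≤ a ∧ a ≤ 1) ∧ (-1 ≤ b ∧ b ≤ 1) := by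
  refine ⟨⟨?_, ?_⟩, ?_, ?_⟩
  · linarith [h 1 1 0]
  · linarith [h 1 (-1) 0]
  · linarith [h 1 0 1]
  · linarith [h 1 0 (-1)]

lemma G3_abs {a b t : ℝ} (h : G3 a b t) : |t - a*b| ≤ sin (arccos a) * sin (arccos b) := by
  obtain ⟨⟨h1, h2⟩, h3, h4⟩ := G3_bd h
  rw [sin_arccos, sin_arccos, ← sqrt_mul (by nlinarith)]
  exact abs_le_sqrt (G3_sq h)

lemma G3_upper {a b t : ℝ} (h : G3 a b t) : t ≤ cos (arccos a - arccos b) := by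
  obtain ⟨⟨h1, h2⟩, h3, h4⟩ := G3_bd h
  rw [cos_sub, cos_arccos h1 h2, cos_arccos h3 h4]
  linarith [(abs_le.1 (G3_abs h)).2]

lemma G3_lower {a b t : ℝ} (h : G3 a b t) : cos (arccos a + arccos b) ≤ t := by
  obtain ⟨⟨h1, h2⟩, h3, h4⟩ := G3_bd h
  rw [cos_add, cos_arccos h1 h2, cos_arccos h3 h4]
  linarith [(abs_le.1 (G3_abs h)).1]

/-- Convex outer set. -/
def KSet : Set ((Fin 2 → ℝ) × (Fin 2 → ℝ)) :=
  {b | ∃ s t x y : ℝ, G3 (b.1 0) (b.1 1) s ∧ G3 x y t ∧ t ≤ s ∧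
    1 - 2 * b.2 0 ≤ x ∧ 1 - 2 * b.2 1 ≤ y}

lemma G3_convex {a b t a' b' t' p q : ℝ} (h : G3 a b t) (h' : G3 a' b' t')
    (hp : 0 ≤ p) (hq : 0 ≤ q) (hpq : p + q = 1) :
    G3 (p*a+q*a') (p*b+q*b') (p*t+q*t') := by
  intro x y z
  have e1 := mul_nonneg hp (h x y z)
  have e2 := mul_nonneg hq (h' x y z)
  have : q = 1 - p := by linarith
  subst this
  linarith

lemma KSet_convex : Convex ℝ KSet := by
  rintro ⟨E, w⟩ ⟨s, t, x, y, h1, h2, h3, h4, h5⟩ ⟨E', w'⟩ ⟨s', t', x', y', h1', h2', h3', h4', h5'⟩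
    p q hp hq hpq
  refine ⟨p*s+q*s', p*t+q*t', p*x+q*x', p*y+q*y', ?_, G3_convex h2 h2' hp hq hpq, ?_, ?_, ?_⟩
  · simpa using G3_convex h1 h1' hp hq hpq
  · nlinarith
  · have e1 := mul_le_mul_of_nonneg_left h4 hp
    have e2 := mul_le_mul_of_nonneg_left h4' hq
    simp at *
    linarith
  · have e1 := mul_le_mul_of_nonneg_left h5 hp
    have e2 := mul_le_mul_of_nonneg_left h5' hq
    simp at *
    linarith

lemma KSet_angle {E w : Fin 2 → ℝ} (h : (E, w) ∈ KSet) (hs : w 0 + w 1 ≤ 1) :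
    |arccos (E 0) - arccos (E 1)| ≤ arccos (1 - 2 * w 0) + arccos (1 - 2 * w 1) := by
  obtain ⟨s, t, x, y, h1, h2, h3, h4, h5⟩ := h
  have hsum := arccos_add_le (x := 1 - 2*w 0) (y := 1-2*w 1) (by linarith)
  have u := G3_upper h1
  have l := G3_lower h2
  have m0 := arccos_le_arccos h4
  have m1 := arccos_le_arccos h5
  simp only at u m0 m1
  refine le_trans ?_ (add_le_add m0 m1)
  have hc : cos (arccos x + arccos y) ≤ cos |arccos (E 0) - arccos (E 1)| := by
    rw [cos_abs]; linarith
  have := arccos_nonneg (E 0)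
  have := arccos_nonneg (E 1)
  have := arccos_le_pi (E 0)
  have := arccos_le_pi (E 1)
  have := arccos_nonneg x
  have := arccos_nonneg y
  exact (strictAntiOn_cos.le_iff_ge (by constructor <;> linarith) 
    ⟨by positivity, abs_le.2 ⟨by linarith, by linarith⟩⟩).1 hc

lemma mem_KSet {E w : Fin 2 → ℝ} {w0 w1 : ℝ} (hE : ∀ x, -1 ≤ E x ∧ E x ≤ 1)
    (h0 : 0 ≤ w0) (h0' : w0 ≤ 1) (h1 : 0 ≤ w1) (h1' : w1 ≤ 1) (hw0 : w0 ≤ w 0) (hw1 : w1 ≤ w 1)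
    (h : √(1 - w0) * √(1 - w1) - √w0 * √w1 ≤
      (√(1 + E 0) * √(1 + E 1) + √(1 - E 0) * √(1 - E 1)) / 2) : (E, w) ∈ KSet := by
  have hG := G3_cos (arccos (E 0)) (arccos (E 1))
  rw [cos_arccos (hE 0).1 (hE 0).2, cos_arccos (hE 1).1 (hE 1).2] at hG
  by_cases hs : w0 + w1 ≤ 1
  · rw [key_iff _ _ _ _ (hE 0) (hE 1) h0 h1 hs] at h
    have hsum := arccos_add_le (x := 1 - 2*w0) (y := 1-2*w1) (by linarith)
    have hG2 := G3_cos' (arccos (1-2*w0)) (arccos (1-2*w1))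
    rw [cos_arccos (by linarith) (by linarith), cos_arccos (by linarith) (by linarith)] at hG2
    refine ⟨_, _, _, _, hG, hG2, ?_, ?_, ?_⟩
    · rw [← cos_abs (arccos (E 0) - arccos (E 1))]
      exact cos_le_cos_of_nonneg_of_le_pi (abs_nonneg _) hsum h
    · simp only; linarith
    · simp only; linarith
  · refine ⟨_, -1, -(1-2*w1), 1-2*w1, hG, ?_, neg_one_le_cos _, ?_, ?_⟩
    · intro x y z
      have : 0 ≤ (y - z - (1-2*w1)*x)^2 + (1 - (1-2*w1)^2) * x^2 :=
        add_nonneg (sq_nonneg _) (mul_nonneg (by nlinarith) (sq_nonneg _))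
      linarith
    · simp only; linarith
    · simp only; linarith


@[reducible]
def psdCore {d : ℕ} {M : Matrix (Fin d) (Fin d) ℂ} (hM : M.PosSemidef) :
    PreInnerProductSpace.Core ℂ (Fin d → ℂ) where
  inner x y := star x ⬝ᵥ (M *ᵥ y)
  conj_inner_symm x y := by
    rw [starRingEnd_apply, ← star_dotProduct_star, star_star, star_mulVec, ← dotProduct_mulVec,
      hM.isHermitian.eq]
  re_inner_nonneg x := hM.re_dotProduct_nonneg x
  add_left := by simp [add_dotProduct]
  smul_left := by simp

lemma psd_cs {d : ℕ} {M : Matrix (Fin d) (Fin d) ℂ} (hM : M.PosSemidef) (u w : Fin d → ℂ) :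
    ‖star u ⬝ᵥ (M *ᵥ w)‖ ≤ √(star u ⬝ᵥ (M *ᵥ u)).re * √(star w ⬝ᵥ (M *ᵥ w)).re :=
  @InnerProductSpace.Core.norm_inner_le_norm ℂ (Fin d → ℂ) _ _ _ (psdCore hM) u w

lemma decomp {d : ℕ} {R : Matrix (Fin d) (Fin d) ℂ} (hR : R.PosSemidef) (ht : R.trace = 1) :
    ∃ (p : Fin d → ℝ) (u : Fin d → Fin d → ℂ), (∀ i, 0 ≤ p i) ∧ ∑ i, p i = 1 ∧
      (∀ i, star (u i) ⬝ᵥ u i = 1) ∧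
      ∀ A : Matrix (Fin d) (Fin d) ℂ, (R * A).trace = ∑ i, (p i : ℂ) * (star (u i) ⬝ᵥ (A *ᵥ u i)) := by
  have hH := hR.isHermitian
  have hU : star (hH.eigenvectorUnitary : Matrix (Fin d) (Fin d) ℂ) *
      (hH.eigenvectorUnitary : Matrix (Fin d) (Fin d) ℂ) = 1 := by simp
  refine ⟨hH.eigenvalues, fun i k => (hH.eigenvectorUnitary : Matrix (Fin d) (Fin d) ℂ) k i,
    hR.eigenvalues_nonneg, ?_, ?_, ?_⟩
  · have := hH.trace_eq_sum_eigenvalues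
    rw [ht] at this
    have h2 := congrArg Complex.re this.symm
    simpa using h2
  · intro i
    have := congrFun (congrFun hU i) i
    simpa [Matrix.mul_apply, dotProduct, star_apply] using this
  · intro A
    conv_lhs => rw [hH.spectral_theorem, Unitary.conjStarAlgAut_apply]
    rw [mul_assoc, mul_assoc, trace_mul_comm, mul_assoc]
    simp only [trace, diag, diagonal_mul]
    refine Finset.sum_congr rfl fun i _ => ?_
    simp only [Function.comp, mul_assoc]
    congr 1

lemma proj_psd {d : ℕ} {v : Fin d → ℂ} (hv : star v ⬝ᵥ v = 1) :
    (1 - vecMulVec v (star v)).PosSemidef := by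
  have h2 : vecMulVec v (star v) * vecMulVec v (star v) = vecMulVec v (star v) := by
    rw [vecMulVec_mul_vecMulVec, hv]; simp
  have h1 : (1 - vecMulVec v (star v))ᴴ = 1 - vecMulVec v (star v) := by
    simp [conjTranspose_vecMulVec]
  have h3 : (1 - vecMulVec v (star v))ᴴ * (1 - vecMulVec v (star v)) = 1 - vecMulVec v (star v) := by
    rw [h1, mul_sub, sub_mul, sub_mul, h2]; simp
  rw [← h3]
  exact posSemidef_conjTranspose_mul_self _

lemma proj_q {d : ℕ} (v u w : Fin d → ℂ) :
    star u ⬝ᵥ ((1 - vecMulVec v (star v)) *ᵥ w) =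
      star u ⬝ᵥ w - (star u ⬝ᵥ v) * (star v ⬝ᵥ w) := by
  rw [sub_mulVec, dotProduct_sub, one_mulVec, vecMulVec_mulVec]
  simp [mul_comm]

lemma star_dot {d : ℕ} (u v : Fin d → ℂ) : star u ⬝ᵥ v = star (star v ⬝ᵥ u) := by
  rw [← star_dotProduct_star, star_star, dotProduct_comm]

lemma proj_self {d : ℕ} (v u : Fin d → ℂ) (hu : star u ⬝ᵥ u = 1) :
    (star u ⬝ᵥ ((1 - vecMulVec v (star v)) *ᵥ u)).re = 1 - ‖star v ⬝ᵥ u‖^2 := by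
  rw [proj_q, hu, star_dot u v]
  have : star (star v ⬝ᵥ u) * (star v ⬝ᵥ u) = ((‖star v ⬝ᵥ u‖^2 : ℝ) : ℂ) := by
    rw [Complex.star_def, Complex.conj_mul']; simp
  rw [this, Complex.sub_re, Complex.ofReal_re]; simp

lemma pure_mem {d : ℕ} {M O : Matrix (Fin d) (Fin d) ℂ} {v : Fin d → ℂ}
    (hM1 : (1 - M).PosSemidef) (hM2 : (1 + M).PosSemidef) (hv : star v ⬝ᵥ v = 1)
    (hO : (O - (1 - vecMulVec v (star v))).PosSemidef) (u : Fin 2 → Fin d → ℂ)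
    (hu : ∀ x, star (u x) ⬝ᵥ u x = 1) (E w : Fin 2 → ℝ)
    (hE : ∀ x, E x = (star (u x) ⬝ᵥ (M *ᵥ u x)).re)
    (hw : ∀ x, w x = (star (u x) ⬝ᵥ (O *ᵥ u x)).re) : (E, w) ∈ KSet := by
  have hP := proj_psd hv
  have m1 : ∀ x, (star (u x) ⬝ᵥ ((1 - M) *ᵥ u x)).re = 1 - E x := by
    intro x
    rw [sub_mulVec, dotProduct_sub, one_mulVec, hu, hE]; simp
  have m2 : ∀ x, (star (u x) ⬝ᵥ ((1 + M) *ᵥ u x)).re = 1 + E x := by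
    intro x
    rw [add_mulVec, dotProduct_add, one_mulVec, hu, hE]; simp
  have p0 : ∀ x, 0 ≤ 1 - ‖star v ⬝ᵥ u x‖^2 := by
    intro x
    rw [← proj_self v _ (hu x)]
    exact hP.re_dotProduct_nonneg _
  have p1 : ∀ x, 1 - ‖star v ⬝ᵥ u x‖^2 ≤ w x := by
    intro x
    have := hO.re_dotProduct_nonneg (u x)
    rw [sub_mulVec, dotProduct_sub, RCLike.re_to_complex, Complex.sub_re, proj_self v _ (hu x),
      ← hw] at this
    linarith
  have p2 : ∀ x, 1 - ‖star v ⬝ᵥ u x‖^2 ≤ 1 := fun x => by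
    linarith [sq_nonneg ‖star v ⬝ᵥ u x‖]
  refine mem_KSet (w0 := 1 - ‖star v ⬝ᵥ u 0‖^2) (w1 := 1 - ‖star v ⬝ᵥ u 1‖^2) ?_
    (p0 0) (p2 0) (p0 1) (p2 1) (p1 0) (p1 1) ?_
  · intro x
    have a := hM1.re_dotProduct_nonneg (u x)
    have b := hM2.re_dotProduct_nonneg (u x)
    rw [RCLike.re_to_complex] at a b
    rw [m1] at a
    rw [m2] at b
    constructor <;> linarith
  · have c1 := psd_cs hM1 (u 0) (u 1)
    have c2 := psd_cs hM2 (u 0) (u 1)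
    have c3 := psd_cs hP (u 0) (u 1)
    rw [m1, m1] at c1
    rw [m2, m2] at c2
    rw [proj_self v _ (hu 0), proj_self v _ (hu 1), proj_q] at c3
    have s : (star (u 0) ⬝ᵥ ((1 - M) *ᵥ u 1)) + (star (u 0) ⬝ᵥ ((1 + M) *ᵥ u 1))
        = 2 * (star (u 0) ⬝ᵥ u 1) := by
      rw [sub_mulVec, add_mulVec, dotProduct_sub, dotProduct_add, one_mulVec]; ring
    have c4 := norm_add_le (star (u 0) ⬝ᵥ ((1 - M) *ᵥ u 1)) (star (u 0) ⬝ᵥ ((1 + M) *ᵥ u 1))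
    rw [s, norm_mul, Complex.norm_ofNat] at c4
    have c5 := norm_sub_norm_le ((star (u 0) ⬝ᵥ v) * (star v ⬝ᵥ u 1)) (star (u 0) ⬝ᵥ u 1)
    rw [norm_sub_rev, norm_mul, star_dot (u 0) v, norm_star, ← star_dot] at c5
    have r0 : ∀ x, √(1 - (1 - ‖star v ⬝ᵥ u x‖^2)) = ‖star v ⬝ᵥ u x‖ := by
      intro x
      rw [sub_sub_cancel, sqrt_sq (norm_nonneg _)]
    rw [r0, r0]
    linarith

lemma rep_mem {E ω : Fin 2 → ℝ} (h : IsQuantumRep E ω) : (E, ω) ∈ KSet := by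
  obtain ⟨d, ρ, M, O, v, hρ, ht, -, hM1, hM2, -, -, hv, hO, hE, hw⟩ := h
  have hv' : star v ⬝ᵥ v = 1 := by
    have : star v ⬝ᵥ v = ((∑ i, Complex.normSq (v i) : ℝ) : ℂ) := by
      simp [dotProduct, Complex.normSq_eq_conj_mul_self]
    rw [this, hv]; simp
  choose p u hp hsum hu htr using fun x => decomp (hρ x) (ht x)
  have hE' : ∀ x, E x = ∑ i, p x i * (star (u x i) ⬝ᵥ (M *ᵥ u x i)).re := by
    intro x
    have := congrArg Complex.re ((hE x).symm.trans (htr x M))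
    simpa using this
  have hw' : ∀ x, ∑ i, p x i * (star (u x i) ⬝ᵥ (O *ᵥ u x i)).re ≤ ω x := by
    intro x
    have := hw x
    rw [htr x O] at this
    simpa using this
  let pt : Fin d × Fin d → (Fin 2 → ℝ) × (Fin 2 → ℝ) := fun ij =>
    (fun x => (star (u x (![ij.1, ij.2] x)) ⬝ᵥ (M *ᵥ u x (![ij.1, ij.2] x))).re,
     fun x => (star (u x (![ij.1, ij.2] x)) ⬝ᵥ (O *ᵥ u x (![ij.1, ij.2] x))).re)
  have hpt : ∀ ij, pt ij ∈ KSet := fun ij =>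
    pure_mem hM1 hM2 hv' hO (fun x => u x (![ij.1, ij.2] x)) (fun x => hu x _) _ _
      (fun _ => rfl) (fun _ => rfl)
  have hmix := KSet_convex.sum_mem (t := Finset.univ) (w := fun ij : Fin d × Fin d => p 0 ij.1 * p 1 ij.2)
    (z := pt) (fun ij _ => mul_nonneg (hp 0 _) (hp 1 _))
    (by rw [Fintype.sum_prod_type, ← Finset.sum_mul_sum, hsum, hsum, one_mul]) (fun ij _ => hpt ij)
  have g0 : ∀ f : Fin d → ℝ, ∑ ij : Fin d × Fin d, p 0 ij.1 * p 1 ij.2 * f ij.1 = ∑ i, p 0 i * f i := by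
    intro f
    rw [Fintype.sum_prod_type]
    refine Finset.sum_congr rfl fun i _ => ?_
    simp only
    rw [← Finset.sum_mul, ← Finset.mul_sum, hsum, mul_one]
  have g1 : ∀ f : Fin d → ℝ, ∑ ij : Fin d × Fin d, p 0 ij.1 * p 1 ij.2 * f ij.2 = ∑ i, p 1 i * f i := by
    intro f
    rw [Fintype.sum_prod_type_right]
    refine Finset.sum_congr rfl fun i _ => ?_
    simp only
    rw [← Finset.sum_mul, ← Finset.sum_mul, hsum, one_mul]
  obtain ⟨s, t, x, y, h1, h2, h3, h4, h5⟩ := hmix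
  have e0 := g0 (fun i => (star (u 0 i) ⬝ᵥ (M *ᵥ u 0 i)).re)
  have e1 := g1 (fun i => (star (u 1 i) ⬝ᵥ (M *ᵥ u 1 i)).re)
  have o0 := g0 (fun i => (star (u 0 i) ⬝ᵥ (O *ᵥ u 0 i)).re)
  have o1 := g1 (fun i => (star (u 1 i) ⬝ᵥ (O *ᵥ u 1 i)).re)
  rw [← hE'] at e0 e1
  have w0 := hw' 0
  have w1 := hw' 1
  simp only [Prod.fst_sum, Prod.snd_sum, Finset.sum_apply, Prod.smul_fst, Prod.smul_snd,
    Pi.smul_apply, smul_eq_mul, pt, cons_val_zero, cons_val_one] at h1 h4 h5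
  refine ⟨s, t, x, y, ?_, h2, h3, ?_, ?_⟩
  · simpa only [e0, e1] using h1
  · simp only; linarith
  · simp only; linarith

lemma sin_sq_le {x a : ℝ} (h : |x| ≤ a) (ha : a ≤ π/2) : sin x ^2 ≤ sin a ^2 := by
  rw [sq_le_sq, abs_sin_eq_sin_abs_of_abs_le_pi (by linarith [pi_pos])]
  exact (le_trans (sin_le_sin_of_le_of_le_pi_div_two (by linarith [abs_nonneg x, pi_pos]) ha h) (le_abs_self _))

def rv (a : ℝ) : Fin 2 → ℂ := ![(cos a : ℂ), (sin a : ℂ)]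

lemma rv_dot (a b : ℝ) : star (rv a) ⬝ᵥ rv b = ((cos (a - b) : ℝ) : ℂ) := by
  simp [rv, dotProduct, Fin.sum_univ_two, cos_sub, Complex.conj_ofReal, -Complex.ofReal_cos, -Complex.ofReal_sin]

lemma trace_pure {d : ℕ} (u : Fin d → ℂ) (A : Matrix (Fin d) (Fin d) ℂ) :
    (vecMulVec u (star u) * A).trace = star u ⬝ᵥ (A *ᵥ u) := by
  rw [trace_mul_comm, mul_vecMulVec, trace_vecMulVec, dotProduct_comm]

lemma rep_of_angle {E ω : Fin 2 → ℝ} (hE : ∀ x, -1 ≤ E x ∧ E x ≤ 1) (hω : ∀ x, 0 ≤ ω x)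
    (hω1 : ∀ x, ω x ≤ 1)
    (h : |arccos (E 0) - arccos (E 1)| ≤ arccos (1 - 2 * ω 0) + arccos (1 - 2 * ω 1)) :
    IsQuantumRep E ω := by
  obtain ⟨φ, hφ⟩ : ∃ φ : ℝ, ∀ x, |arccos (E x) / 2 - φ| ≤ arccos (1 - 2 * ω x) / 2 := by
    have n0 := arccos_nonneg (1 - 2 * ω 0)
    have n1 := arccos_nonneg (1 - 2 * ω 1)
    obtain ⟨ha, hb⟩ := abs_le.1 h
    refine ⟨max (arccos (E 0) / 2 - arccos (1 - 2 * ω 0)/2) (arccos (E 1) / 2 - arccos (1 - 2 * ω 1)/2), ?_⟩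
    rw [Fin.forall_fin_two]
    constructor
    all_goals
      rw [abs_le]
      rcases max_cases (arccos (E 0) / 2 - arccos (1 - 2 * ω 0)/2) (arccos (E 1) / 2 - arccos (1 - 2 * ω 1)/2) with ⟨e, _⟩ | ⟨e, _⟩ <;> rw [e] <;> constructor <;> linarith
  have hvv : star (rv φ) ⬝ᵥ rv φ = 1 := by rw [rv_dot]; simp
  have hP := proj_psd hvv
  refine ⟨2, fun x => vecMulVec (rv (arccos (E x) / 2)) (star (rv (arccos (E x) / 2))),
    diagonal ![1, -1], 1 - vecMulVec (rv φ) (star (rv φ)), rv φ, ?_, ?_, ?_, ?_, ?_, hP.1, ?_, ?_, ?_, ?_, ?_⟩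
  · intro x; exact posSemidef_vecMulVec_self_star _
  · intro x
    rw [trace_vecMulVec, dotProduct_comm, rv_dot]; simp
  · rw [isHermitian_diagonal_iff]
    intro i; fin_cases i <;> simp [IsSelfAdjoint]
  · rw [← diagonal_one, diagonal_sub]
    refine PosSemidef.diagonal ?_
    intro i; fin_cases i <;> simp
    norm_num
  · rw [← diagonal_one, diagonal_add]
    refine PosSemidef.diagonal ?_
    intro i; fin_cases i <;> simp
    norm_num
  · rw [sub_mulVec, vecMulVec_mulVec, hvv]; simp
  · have := sin_sq_add_cos_sq φ
    simp only [rv, Fin.sum_univ_two, cons_val_zero, cons_val_one, Complex.normSq_ofReal]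
    linarith
  · rw [sub_self]; exact PosSemidef.zero
  · intro x
    rw [trace_pure]
    have h1 : cos (arccos (E x) / 2) * cos (arccos (E x) / 2) - sin (arccos (E x) / 2) * sin (arccos (E x) / 2) = E x := by
      rw [← cos_add, add_halves, cos_arccos (hE x).1 (hE x).2]
    have h2 := congrArg Complex.ofReal h1
    rw [← h2]
    clear h2 h1
    generalize arccos (E x) / 2 = θ
    simp [rv, dotProduct, Fin.sum_univ_two, mulVec_diagonal, Complex.conj_ofReal, -Complex.ofReal_cos, -Complex.ofReal_sin]
    ring
  · intro x
    rw [trace_pure, proj_self, rv_dot, Complex.norm_real, norm_eq_abs, sq_abs]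
    · have h1 := sin_sq_le (hφ x) (by linarith [arccos_le_pi (1 - 2 * ω x)])
      have h2 : sin (arccos (1 - 2 * ω x) / 2)^2 = ω x := by
        rw [sin_sq_eq_half_sub, mul_div_cancel₀ _ (by norm_num : (2:ℝ) ≠ 0), cos_arccos (by linarith [hω1 x]) (by linarith [hω x])]
        ring
      have h3 := sin_sq_add_cos_sq (arccos (E x) / 2 - φ)
      rw [← cos_neg, neg_sub]
      linarith
    · rw [rv_dot]; simp

end QuantumSetAux

/-- Corollary 2 (scalar-product closed form of the quantum set). -/
theorem mem_quantumSet_iff_sqrt (E ω : Fin 2 → ℝ)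
    (hE : ∀ x, -1 ≤ E x ∧ E x ≤ 1) (hω : ∀ x, 0 ≤ ω x)
    (hsum : ω 0 + ω 1 ≤ 1) :
    (E, ω) ∈ QuantumSet ↔
      Real.sqrt (1 - ω 0) * Real.sqrt (1 - ω 1) -
          Real.sqrt (ω 0) * Real.sqrt (ω 1) ≤
        (Real.sqrt (1 + E 0) * Real.sqrt (1 + E 1) +
          Real.sqrt (1 - E 0) * Real.sqrt (1 - E 1)) / 2 := by
  have h1 : ∀ x, ω x ≤ 1 := by
    have h0 := hω 0
    have h1 := hω 1
    rw [Fin.forall_fin_two]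
    constructor <;> linarith
  rw [QuantumSetAux.key_iff _ _ _ _ (hE 0) (hE 1) (hω 0) (hω 1) hsum]
  constructor
  · intro h
    refine QuantumSetAux.KSet_angle ?_ hsum
    exact convexHull_min (fun b hb => QuantumSetAux.rep_mem hb) QuantumSetAux.KSet_convex h
  · intro h
    exact subset_convexHull ℝ _ (QuantumSetAux.rep_of_angle hE hω h1 h)

end
end

section
/- A behaviour (E₁,E₂,ω₁,ω₂) belongs to the quantum set Q if and only if there exists a quantum Bell behaviour (⟨A₁B₁⟩,⟨A₁B₂⟩,⟨A₂B₁⟩,⟨A₂B₂⟩) such that ⟨AₓB₁⟩ = Eₓ and ⟨AₓB₂⟩ ≤ 2ωₓ − 1 for x = 1,2. -/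
open scoped ComplexOrder

noncomputable section

open Kronecker in
/-- A quantum Bell behaviour: the four correlators of a two-party Bell
experiment with two binary `±1`-valued measurements per party. -/
def IsBellBehaviour (c : Fin 2 → Fin 2 → ℝ) : Prop :=
  ∃ (dA dB : ℕ) (ρ : Matrix (Fin dA × Fin dB) (Fin dA × Fin dB) ℂ)
    (A : Fin 2 → Matrix (Fin dA) (Fin dA) ℂ)
    (B : Fin 2 → Matrix (Fin dB) (Fin dB) ℂ),
    ρ.PosSemidef ∧ ρ.trace = 1 ∧
    (∀ x, (A x).IsHermitian ∧ A x ^ 2 = 1) ∧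
    (∀ y, (B y).IsHermitian ∧ B y ^ 2 = 1) ∧
    ∀ x y, (ρ * (A x ⊗ₖ B y)).trace = (c x y : ℂ)

/-- The trace of a product of two positive semidefinite matrices is nonnegative. -/
theorem aux_tr_nonneg {n : Type*} [Fintype n] [DecidableEq n] {R A : Matrix n n ℂ}
    (hR : R.PosSemidef) (hA : A.PosSemidef) : 0 ≤ (R * A).trace.re := by
  obtain ⟨L, hL⟩ : ∃ L : Matrix n n ℂ, R = L.conjTranspose * L := by
    open scoped MatrixOrder in
    refine ⟨CFC.sqrt R, ?_⟩
    have h1 : (CFC.sqrt R).IsHermitian := (Matrix.nonneg_iff_posSemidef.1 (CFC.sqrt_nonneg R)).1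
    rw [h1.eq]
    exact (CFC.sqrt_mul_sqrt_self R hR.nonneg).symm
  rw [hL, Matrix.mul_assoc, Matrix.trace_mul_comm]
  exact (Complex.le_def.mp (hA.mul_mul_conjTranspose_same L).trace_nonneg).1

/-- A real symmetric `2 × 2` matrix with nonnegative diagonal and determinant is
positive semidefinite. -/
theorem aux_psd_two {a b c : ℝ} (ha : 0 ≤ a) (hc : 0 ≤ c) (h : b ^ 2 ≤ a * c) :
    (!![(a : ℂ), (b : ℂ); (b : ℂ), (c : ℂ)]).PosSemidef := by
  have key : ∀ x y : ℝ, 0 ≤ a * x ^ 2 + 2 * b * x * y + c * y ^ 2 := by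
    intro x y
    rcases ha.eq_or_lt with h0 | h0
    · subst h0
      have : b = 0 := by nlinarith
      subst this
      nlinarith [mul_nonneg hc (sq_nonneg y)]
    · have h1 : 0 ≤ a * (a * x ^ 2 + 2 * b * x * y + c * y ^ 2) := by
        nlinarith [sq_nonneg (a * x + b * y), mul_nonneg (sub_nonneg.2 h) (sq_nonneg y)]
      exact nonneg_of_mul_nonneg_right h1 h0
  apply Matrix.PosSemidef.of_dotProduct_mulVec_nonneg
  · ext i j
    fin_cases i <;> fin_cases j <;> simp
  · intro x
    rw [Complex.le_def]
    have h1 := key (x 0).re (x 1).re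
    have h2 := key (x 0).im (x 1).im
    constructor
    · simp [Matrix.mulVec, dotProduct, Fin.sum_univ_two]
      nlinarith
    · simp [Matrix.mulVec, dotProduct, Fin.sum_univ_two]
      ring

/-- The Gram-matrix relaxation. -/
def AuxFeas (E ω : Fin 2 → ℝ) : Prop :=
  ∃ (s : ℝ) (k : Fin 2 → ℝ), ∀ x, k x ≤ 2 * ω x - 1 ∧ ∀ α β γ : ℝ,
    0 ≤ α ^ 2 + β ^ 2 + γ ^ 2 + 2 * s * (β * γ) + 2 * E x * (α * β) + 2 * k x * (α * γ)

theorem aux_convex : Convex ℝ {b : (Fin 2 → ℝ) × (Fin 2 → ℝ) | AuxFeas b.1 b.2} := by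
  rintro ⟨E, ω⟩ ⟨s, k, h⟩ ⟨E', ω'⟩ ⟨s', k', h'⟩ a b ha hb hab
  refine ⟨a * s + b * s', fun x => a * k x + b * k' x, fun x => ⟨?_, fun α β γ => ?_⟩⟩
  · have h1 := mul_le_mul_of_nonneg_left (h x).1 ha
    have h2 := mul_le_mul_of_nonneg_left (h' x).1 hb
    simp at h1 h2 ⊢
    nlinarith
  · have h1 := mul_nonneg ha ((h x).2 α β γ)
    have h2 := mul_nonneg hb ((h' x).2 α β γ)
    obtain rfl : b = 1 - a := by linarith
    simp at h1 h2 ⊢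
    nlinarith

theorem aux_disc {s E k : ℝ} (h : ∀ α β γ : ℝ,
    0 ≤ α ^ 2 + β ^ 2 + γ ^ 2 + 2 * s * (β * γ) + 2 * E * (α * β) + 2 * k * (α * γ)) :
    s ^ 2 ≤ 1 ∧ ∃ p : ℝ, p ^ 2 + k ^ 2 ≤ 1 ∧ p * √(1 - s ^ 2) + s * k = E := by
  have hs : s ^ 2 ≤ 1 := by nlinarith [h 0 1 (-s)]
  have hk : k ^ 2 ≤ 1 := by nlinarith [h 1 0 (-k)]
  refine ⟨hs, ?_⟩
  rcases hs.eq_or_lt with h1 | h1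
  · refine ⟨0, by linarith, ?_⟩
    have h2 := h (-(E - s * k)) 1 (-s)
    have h3 : (E - s * k) ^ 2 ≤ 0 := by nlinarith
    nlinarith
  · have ht : 0 < 1 - s ^ 2 := by linarith
    have hq := Real.sq_sqrt ht.le
    have hq0 := Real.sqrt_pos.2 ht
    refine ⟨(E - s * k) / √(1 - s ^ 2), ?_, ?_⟩
    · have h2 := h (1 - s ^ 2) (-(E - s * k)) (-(k - s * E))
      have h3 : 0 ≤ (1 - s ^ 2) * (1 + 2 * s * E * k - s ^ 2 - E ^ 2 - k ^ 2) := by nlinarith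
      have h4 := nonneg_of_mul_nonneg_right h3 ht
      rw [div_pow, hq]
      have : (E - s * k) ^ 2 / (1 - s ^ 2) ≤ 1 - k ^ 2 := by
        rw [div_le_iff₀ ht]; nlinarith
      linarith
    · rw [div_mul_cancel₀ _ hq0.ne']; ring

theorem aux_feas_rep {E ω : Fin 2 → ℝ} (h : AuxFeas E ω) : IsQuantumRep E ω := by
  obtain ⟨s, k, h⟩ := h
  have hs := (aux_disc (h 0).2).1
  choose p hp1 hp2 using fun x => (aux_disc (h x).2).2
  set t := √(1 - s ^ 2) with ht
  have htt : t ^ 2 = 1 - s ^ 2 := Real.sq_sqrt (by linarith)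
  have hs1 : -1 ≤ s ∧ s ≤ 1 := abs_le.1 ((sq_le_one_iff_abs_le_one s).1 hs)
  have hk (x) : -1 ≤ k x ∧ k x ≤ 1 :=
    abs_le.1 ((sq_le_one_iff_abs_le_one _).1 (by nlinarith [hp1 x, sq_nonneg (p x)]))
  refine ⟨2, fun x => !![(((1 + k x) / 2 : ℝ) : ℂ), ((p x / 2 : ℝ) : ℂ);
      ((p x / 2 : ℝ) : ℂ), (((1 - k x) / 2 : ℝ) : ℂ)],
    !![(s : ℂ), (t : ℂ); (t : ℂ), ((-s : ℝ) : ℂ)], !![1, 0; 0, 0], ![0, 1],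
    ?_, ?_, ?_, ?_, ?_, ?_, ?_, ?_, ?_, ?_, ?_⟩
  · intro x
    apply aux_psd_two
    · linarith [hk x]
    · linarith [hk x]
    · nlinarith [hp1 x]
  · intro x
    simp [Matrix.trace_fin_two]
    ring
  · ext i j
    fin_cases i <;> fin_cases j <;> simp
  · convert aux_psd_two (a := 1 - s) (b := -t) (c := 1 + s) (by linarith) (by linarith)
      (by nlinarith) using 1
    ext i j
    fin_cases i <;> fin_cases j <;> simp
  · convert aux_psd_two (a := 1 + s) (b := t) (c := 1 - s) (by linarith) (by linarith)
      (by nlinarith) using 1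
    ext i j
    fin_cases i <;> fin_cases j <;> simp [sub_eq_add_neg]
  · ext i j
    fin_cases i <;> fin_cases j <;> simp
  · ext i
    fin_cases i <;> simp [Matrix.mulVec, dotProduct, Fin.sum_univ_two]
  · simp [Fin.sum_univ_two]
  · convert Matrix.PosSemidef.zero using 1
    ext i j
    fin_cases i <;> fin_cases j <;> simp [Matrix.vecMulVec]
  · intro x
    rw [← hp2 x]
    simp [Matrix.trace_fin_two]
    ring
  · intro x
    have := (h x).1
    simp [Matrix.trace_fin_two]
    linarith

theorem aux_feas_bell {E ω : Fin 2 → ℝ} (h : AuxFeas E ω) :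
    ∃ c : Fin 2 → Fin 2 → ℝ, IsBellBehaviour c ∧
        ∀ x, c x 0 = E x ∧ c x 1 ≤ 2 * ω x - 1 := by
  obtain ⟨s, k, h⟩ := h
  have hs := (aux_disc (h 0).2).1
  choose p hp1 hp2 using fun x => (aux_disc (h x).2).2
  set t := √(1 - s ^ 2) with ht
  have htt : t ^ 2 = 1 - s ^ 2 := Real.sq_sqrt (by linarith)
  have httC : (t : ℂ) ^ 2 = 1 - (s : ℂ) ^ 2 := by exact_mod_cast htt
  obtain ⟨r, hr⟩ : ∃ r : Fin 2 → ℝ, ∀ x, (r x) ^ 2 = 1 - (p x) ^ 2 - (k x) ^ 2 :=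
    ⟨fun x => √(1 - (p x) ^ 2 - (k x) ^ 2), fun x => Real.sq_sqrt (by linarith [hp1 x])⟩
  have hrC (x) : (r x : ℂ) ^ 2 = 1 - (p x : ℂ) ^ 2 - (k x : ℂ) ^ 2 := by exact_mod_cast hr x
  let φ : Fin 2 × Fin 2 → ℂ := fun i => if i.1 = i.2 then 1 else 0
  refine ⟨fun x => ![E x, k x], ⟨2, 2, (1 / 2 : ℝ) • Matrix.vecMulVec φ (star φ),
    fun x => !![(k x : ℂ), p x - Complex.I * r x; p x + Complex.I * r x, -(k x : ℂ)],
    ![!![(s : ℂ), t; t, -(s : ℂ)], !![1, 0; 0, -1]], ?_, ?_, ?_, ?_, ?_⟩,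
    fun x => ⟨rfl, (h x).1⟩⟩
  · exact (Matrix.posSemidef_vecMulVec_self_star φ).smul (by norm_num)
  · simp [Matrix.trace, Fintype.sum_prod_type, Matrix.vecMulVec, φ]
  · intro x
    refine ⟨?_, ?_⟩
    · ext i j
      fin_cases i <;> fin_cases j <;> simp [sub_eq_add_neg]
    · have := hrC x
      ext i j
      fin_cases i <;> fin_cases j <;> simp [pow_two, Matrix.mul_apply, Fin.sum_univ_two] <;>
        ring_nf <;> simp [Complex.I_sq, this] <;> ring
  · intro y
    refine ⟨?_, ?_⟩
    · ext i j
      fin_cases y <;> fin_cases i <;> fin_cases j <;> simp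
    · ext i j
      fin_cases y <;> fin_cases i <;> fin_cases j <;>
        simp [pow_two, Matrix.mul_apply, Fin.sum_univ_two] <;>
        ring_nf <;> simp [httC]
  · intro x y
    fin_cases y
    · have : (E x : ℂ) = p x * t + s * k x := by exact_mod_cast (hp2 x).symm
      simp [Matrix.trace, Matrix.mul_apply, Fintype.sum_prod_type, Fin.sum_univ_two,
        Matrix.vecMulVec, φ, this]
      ring
    · simp [Matrix.trace, Matrix.mul_apply, Fintype.sum_prod_type, Fin.sum_univ_two,
        Matrix.vecMulVec, φ]
      ring

open Kronecker in
theorem aux_bell_feas {E ω : Fin 2 → ℝ} {c : Fin 2 → Fin 2 → ℝ} (hc : IsBellBehaviour c)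
    (h : ∀ x, c x 0 = E x ∧ c x 1 ≤ 2 * ω x - 1) : AuxFeas E ω := by
  obtain ⟨dA, dB, ρ, A, B, hρ, htr, hA, hB, hc⟩ := hc
  let b : Fin 2 → Matrix (Fin dA × Fin dB) (Fin dA × Fin dB) ℂ := fun y => 1 ⊗ₖ B y
  have hb2 (y) : b y * b y = 1 := by
    have h2 : B y * B y = 1 := by rw [← pow_two, (hB y).2]
    simp [b, ← Matrix.mul_kronecker_mul, h2]
  have hbH (y) : (b y).conjTranspose = b y := by
    simp [b, Matrix.conjTranspose_kronecker, (hB y).1.eq]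
  refine ⟨((ρ * (b 0 * b 1)).trace.re + (ρ * (b 1 * b 0)).trace.re) / 2, fun x => c x 1,
    fun x => ⟨(h x).2, fun α β γ => ?_⟩⟩
  let a : Matrix (Fin dA × Fin dB) (Fin dA × Fin dB) ℂ := A x ⊗ₖ 1
  have ha2 : a * a = 1 := by
    have h2 : A x * A x = 1 := by rw [← pow_two, (hA x).2]
    simp [a, ← Matrix.mul_kronecker_mul, h2]
  have haH : a.conjTranspose = a := by
    simp [a, Matrix.conjTranspose_kronecker, (hA x).1.eq]
  have hab (y) : a * b y = A x ⊗ₖ B y := by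
    simp [a, b, ← Matrix.mul_kronecker_mul]
  have hba (y) : b y * a = A x ⊗ₖ B y := by
    simp [a, b, ← Matrix.mul_kronecker_mul]
  have h0 := hc x 0
  have h1 := hc x 1
  rw [(h x).1] at h0
  let X := (α : ℂ) • a + (β : ℂ) • b 0 + (γ : ℂ) • b 1
  have hX : X.conjTranspose = X := by
    simp [X, haH, hbH]
  have hp := aux_tr_nonneg hρ (Matrix.posSemidef_conjTranspose_mul_self X)
  rw [hX] at hp
  have hXX : X * X = ((α : ℂ) ^ 2 + β ^ 2 + γ ^ 2) • (1 : Matrix _ _ ℂ)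
      + ((β : ℂ) * γ) • (b 0 * b 1) + ((β : ℂ) * γ) • (b 1 * b 0)
      + (2 * (α : ℂ) * β) • (A x ⊗ₖ B 0) + (2 * (α : ℂ) * γ) • (A x ⊗ₖ B 1) := by
    simp only [X, add_mul, mul_add, smul_mul_assoc, mul_smul_comm, ha2, hb2, hab, hba]
    module
  rw [hXX] at hp
  simp only [mul_add, Matrix.trace_add, mul_smul_comm, Matrix.trace_smul, h0, h1, mul_one, htr,
    smul_eq_mul] at hp
  simp [pow_two] at hp
  simp only []
  nlinarith

theorem aux_rep_bound {d : ℕ} {R A V : Matrix (Fin d) (Fin d) ℂ} {a m f : ℝ}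
    (hR : R.PosSemidef) (hA : A.PosSemidef) (hV : V.conjTranspose = V)
    (hVA : V * A * V = (m : ℂ) • V) (hf : (R * V).trace.re = f) (ha : (R * A).trace.re = a) :
    (((R * (A * V)).trace.re + (R * (V * A)).trace.re) / 2) ^ 2 ≤ f * (a * m) := by
  have key : ∀ t : ℝ, 0 ≤ a * (t * t) +
      ((R * (A * V)).trace.re + (R * (V * A)).trace.re) * t + m * f := by
    intro t
    have h1 := aux_tr_nonneg hR (hA.conjTranspose_mul_mul_same ((t : ℂ) • 1 + V))
    have h2 : ((t : ℂ) • 1 + V).conjTranspose * A * ((t : ℂ) • 1 + V) =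
        ((t : ℂ) * t) • A + (t : ℂ) • (A * V) + (t : ℂ) • (V * A) + (m : ℂ) • V := by
      rw [← hVA]
      simp only [Matrix.conjTranspose_add, Matrix.conjTranspose_smul, hV,
        Matrix.conjTranspose_one, add_mul, mul_add, smul_mul_assoc, mul_smul_comm, one_mul,
        mul_one]
      simp
      module
    rw [h2] at h1
    simp only [mul_add, Matrix.trace_add, mul_smul_comm, Matrix.trace_smul, smul_eq_mul] at h1
    simp [hf, ha] at h1
    nlinarith
  have := discrim_le_zero key
  unfold discrim at this
  nlinarith

theorem aux_rep_feas {E ω : Fin 2 → ℝ} (h : IsQuantumRep E ω) : AuxFeas E ω := by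
  obtain ⟨d, ρ, M, O, v, hρ, htr, hM, hM1, hM2, hO, hOv, hv, hOV, hE, hω⟩ := h
  have hvv : star v ⬝ᵥ v = 1 := by
    have : (((∑ i, Complex.normSq (v i) : ℝ)) : ℂ) = 1 := by rw [hv]; simp
    rw [← this]
    simp [dotProduct, Complex.normSq_eq_conj_mul_self]
  set V := Matrix.vecMulVec v (star v) with hVdef
  have hVpsd : V.PosSemidef := Matrix.posSemidef_vecMulVec_self_star v
  have hV : V.conjTranspose = V := hVpsd.1
  have hVX (X : Matrix (Fin d) (Fin d) ℂ) : V * X * V = (star v ⬝ᵥ X.mulVec v) • V := by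
    rw [hVdef, Matrix.vecMulVec_mul, Matrix.vecMulVec_mul_vecMulVec, Matrix.dotProduct_mulVec]
    ext i j
    simp [Matrix.vecMulVec]
    try ring
  obtain ⟨m, hm⟩ : ∃ m : ℝ, star v ⬝ᵥ M.mulVec v = (m : ℂ) := by
    refine ⟨(star v ⬝ᵥ M.mulVec v).re, ?_⟩
    have h1 := Complex.le_def.1 (hM2.dotProduct_mulVec_nonneg v)
    apply Complex.ext
    · simp
    · have := h1.2
      simp [Matrix.add_mulVec, hvv] at this
      simp [← this]
  have hA1 : V * (1 + M) * V = ((1 + m : ℝ) : ℂ) • V := by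
    rw [hVX]; simp [Matrix.add_mulVec, hvv, hm]
  have hA2 : V * (1 - M) * V = ((1 - m : ℝ) : ℂ) • V := by
    rw [hVX]; simp [Matrix.sub_mulVec, hvv, hm]
  have hm1 : 0 ≤ 1 + m := by
    have h1 := Complex.le_def.1 (hM2.dotProduct_mulVec_nonneg v)
    simpa [Matrix.add_mulVec, hvv, hm] using h1.1
  have hm2 : 0 ≤ 1 - m := by
    have h1 := Complex.le_def.1 (hM1.dotProduct_mulVec_nonneg v)
    simpa [Matrix.sub_mulVec, hvv, hm] using h1.1
  have hE1 (x) : (ρ x * (1 + M)).trace.re = 1 + E x := by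
    simp [mul_add, htr, hE]
  have hE2 (x) : (ρ x * (1 - M)).trace.re = 1 - E x := by
    simp [mul_sub, htr, hE]
  have hE1' (x) : 0 ≤ 1 + E x := by rw [← hE1]; exact aux_tr_nonneg (hρ x) hM2
  have hE2' (x) : 0 ≤ 1 - E x := by rw [← hE2]; exact aux_tr_nonneg (hρ x) hM1
  have hw (x) : 1 - (ρ x * V).trace.re ≤ ω x := by
    have h1 := aux_tr_nonneg (hρ x) hOV
    simp [mul_sub, htr] at h1
    linarith [hω x]
  have hm3 : 0 ≤ 1 - m ^ 2 := by nlinarith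
  have hE3 (x) : 0 ≤ 1 - E x ^ 2 := by nlinarith [hE1' x, hE2' x]
  refine ⟨-m, fun x => -(E x * m + √(1 - E x ^ 2) * √(1 - m ^ 2)), fun x => ⟨?_, ?_⟩⟩
  · have hf0 := aux_tr_nonneg (hρ x) hVpsd
    have b1 := aux_rep_bound (hρ x) hM2 hV hA1 rfl (hE1 x)
    have b2 := aux_rep_bound (hρ x) hM1 hV hA2 rfl (hE2 x)
    set f := (ρ x * V).trace.re with hf
    have hsum : ((ρ x * ((1 + M) * V)).trace.re + (ρ x * (V * (1 + M))).trace.re) / 2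
      + ((ρ x * ((1 - M) * V)).trace.re + (ρ x * (V * (1 - M))).trace.re) / 2 = 2 * f := by
      simp [mul_add, add_mul, mul_sub, sub_mul, hf]
      ring
    set y := ((ρ x * ((1 + M) * V)).trace.re + (ρ x * (V * (1 + M))).trace.re) / 2
    set z := ((ρ x * ((1 - M) * V)).trace.re + (ρ x * (V * (1 - M))).trace.re) / 2
    have hw := hw x
    rw [← hf] at hw
    set a := (1 + E x) * (1 + m) with ha
    set b := (1 - E x) * (1 - m) with hb
    have ha0 : 0 ≤ a := mul_nonneg (hE1' x) hm1
    have hb0 : 0 ≤ b := mul_nonneg (hE2' x) hm2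
    have hab : √(1 - E x ^ 2) * √(1 - m ^ 2) = √a * √b := by
      rw [← Real.sqrt_mul (hE3 x), ← Real.sqrt_mul ha0]
      congr 1
      rw [ha, hb]; ring
    have hy : y ≤ √f * √a := by
      rw [← Real.sqrt_mul hf0]; exact Real.le_sqrt_of_sq_le b1
    have hz : z ≤ √f * √b := by
      rw [← Real.sqrt_mul hf0]; exact Real.le_sqrt_of_sq_le b2
    have hff := Real.sq_sqrt hf0
    have haa := Real.sq_sqrt ha0
    have hbb := Real.sq_sqrt hb0
    have hg0 : 0 ≤ √a + √b := by positivity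
    have h4 : 2 * √f ≤ √a + √b := by
      by_contra hcon
      push Not at hcon
      have hfp : 0 < √f := by linarith
      nlinarith
    have h5 : (2 * √f) ^ 2 ≤ (√a + √b) ^ 2 :=
      pow_le_pow_left₀ (by positivity) h4 2
    have h6 : 4 * f ≤ a + b + 2 * (√a * √b) := by nlinarith
    have h7 : a + b = 2 + 2 * (E x * m) := by rw [ha, hb]; ring
    simp only []
    rw [hab]
    linarith
  · intro α β γ
    have hu := Real.sq_sqrt (hE3 x)
    have hw := Real.sq_sqrt hm3
    set u := √(1 - E x ^ 2)
    set w := √(1 - m ^ 2)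
    have : α ^ 2 + β ^ 2 + γ ^ 2 + 2 * -m * (β * γ) + 2 * E x * (α * β)
        + 2 * -(E x * m + u * w) * (α * γ)
        = (α * E x + β - γ * m) ^ 2 + (α * u - γ * w) ^ 2 := by
      linear_combination (-α ^ 2) * hu - γ ^ 2 * hw
    simp only []
    rw [this]
    positivity

/-- Proposition 5: mapping between the energy-constrained prepare-and-measure
scenario and the Bell-CHSH scenario. -/
theorem mem_quantumSet_iff_bell (E ω : Fin 2 → ℝ) :
    (E, ω) ∈ QuantumSet ↔
      ∃ c : Fin 2 → Fin 2 → ℝ, IsBellBehaviour c ∧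
        ∀ x, c x 0 = E x ∧ c x 1 ≤ 2 * ω x - 1 := by
  constructor
  · intro h
    have h1 : QuantumSet ⊆ {b : (Fin 2 → ℝ) × (Fin 2 → ℝ) | AuxFeas b.1 b.2} :=
      convexHull_min (fun b hb => aux_rep_feas hb) aux_convex
    exact aux_feas_bell (h1 h)
  · rintro ⟨c, hc, h⟩
    exact subset_convexHull ℝ _ (aux_feas_rep (aux_bell_feas hc h))

end
end
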